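/- arXiv:math/0405494 — 5 statements merged into one kernel-verified Lean document; each statement's English description precedes it below -/
import Mathlib

section
/- Let X be a càdlàg process with P[ΔX_L ≠ 0] = 0, let ℱ^X be its natural filtration, and let (Xⁿ) be càdlàg processes with natural filtrations ℱⁿ such that Xⁿ converges to X in probability for the Skorokhod topology. Then Γ(L) ≤ liminf_{n→∞} Γₙ(L), where Γ(L) = sup{E[γ(τ, X_τ)] : τ an ℱ^X-stopping time with τ ≤ L} and Γₙ(L) = sup{E[γ(τ, Xⁿ_τ)] : τ an ℱⁿ-stopping time with τ ≤ L}. -/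
open MeasureTheory Filter Set Topology

noncomputable section

/-- A real-valued path is càdlàg on `[0, T]` : right-continuous on `[0,T)` and
with left limits on `(0,T]`. -/
def IsCadlagOn (T : ℝ) (f : ℝ → ℝ) : Prop :=
  (∀ t ∈ Set.Ico (0 : ℝ) T, Filter.Tendsto f (nhdsWithin t (Set.Ioi t)) (nhds (f t))) ∧
  (∀ t ∈ Set.Ioc (0 : ℝ) T, ∃ l : ℝ, Filter.Tendsto f (nhdsWithin t (Set.Iio t)) (nhds l))

/-- The jump of a path at time `t` : `Δf_t = f t - f (t⁻)`. -/
def pathJump (f : ℝ → ℝ) (t : ℝ) : ℝ := f t - Function.leftLim f t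

/-- The natural filtration `ℱ^X_t = σ(X_s : 0 ≤ s ≤ t)` of a process. -/
def natFilt {Ω : Type*} (X : ℝ → Ω → ℝ) (t : ℝ) : MeasurableSpace Ω :=
  ⨆ s ∈ Set.Icc (0 : ℝ) t, MeasurableSpace.comap (X s) (borel ℝ)

/-- The right-continuous filtration associated with the natural filtration of `X` :
`ℱ_t = ⋂_{s > t} ℱ^X_s` (for `t < T`), and `ℱ_T = ℱ^X_T`. -/
def rcFilt {Ω : Type*} (X : ℝ → Ω → ℝ) (T t : ℝ) : MeasurableSpace Ω :=
  if t < T then ⨅ s ∈ Set.Ioc t T, natFilt X s else natFilt X T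

/-- `τ` is a stopping time for the family of σ-fields `F`. -/
def IsStoppingTimeOn {Ω : Type*} (F : ℝ → MeasurableSpace Ω) (τ : Ω → ℝ) : Prop :=
  ∀ t : ℝ, MeasurableSet[F t] {ω | τ ω ≤ t}

/-- The value in optimal stopping with horizon `L`, for the filtration `F`,
the process `X` and the gain function `γ`. -/
def optValue {Ω : Type*} [MeasurableSpace Ω] (P : Measure Ω) (F : ℝ → MeasurableSpace Ω)
    (X : ℝ → Ω → ℝ) (γ : ℝ → ℝ → ℝ) (L : ℝ) : ℝ :=
  sSup {x | ∃ τ : Ω → ℝ, IsStoppingTimeOn F τ ∧ (∀ ω, τ ω ∈ Set.Icc 0 L) ∧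
    x = ∫ ω, γ (τ ω) (X (τ ω) ω) ∂P}

/-- The value in optimal stopping with horizon `L` over stopping times taking their
values in the finite set `s`. -/
def optValueIn {Ω : Type*} [MeasurableSpace Ω] (P : Measure Ω) (F : ℝ → MeasurableSpace Ω)
    (X : ℝ → Ω → ℝ) (γ : ℝ → ℝ → ℝ) (L : ℝ) (s : Finset ℝ) : ℝ :=
  sSup {x | ∃ τ : Ω → ℝ, IsStoppingTimeOn F τ ∧ (∀ ω, τ ω ∈ Set.Icc 0 L) ∧
    (∀ ω, τ ω ∈ s) ∧ x = ∫ ω, γ (τ ω) (X (τ ω) ω) ∂P}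

/-- Convergence in probability for the Skorokhod topology, expressed through random
time changes `Λⁿ`. -/
def SkorokhodTendstoP {Ω : Type*} [MeasurableSpace Ω] (P : Measure Ω) (T : ℝ)
    (Xn : ℕ → ℝ → Ω → ℝ) (X : ℝ → Ω → ℝ) : Prop :=
  ∃ Λ : ℕ → Ω → ℝ → ℝ,
    (∀ n ω, ContinuousOn (Λ n ω) (Set.Icc 0 T)) ∧
    (∀ n ω, StrictMonoOn (Λ n ω) (Set.Icc 0 T)) ∧
    (∀ n ω, Λ n ω 0 = 0) ∧
    (∀ n ω, Λ n ω T = T) ∧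
    (∀ n ω, Set.MapsTo (Λ n ω) (Set.Icc 0 T) (Set.Icc 0 T)) ∧
    (∀ ε : ℝ, 0 < ε → Filter.Tendsto
      (fun n => P {ω | ∃ t ∈ Set.Icc (0 : ℝ) T, ε ≤ |Xn n (Λ n ω t) ω - X t ω|})
      Filter.atTop (nhds 0)) ∧
    (∀ ε : ℝ, 0 < ε → Filter.Tendsto
      (fun n => P {ω | ∃ t ∈ Set.Icc (0 : ℝ) T, ε ≤ |Λ n ω t - t|})
      Filter.atTop (nhds 0))

/-- A càdlàg version of the conditional expectation `E[1_A | m]`. -/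
def cev {Ω : Type*} [MeasurableSpace Ω] (P : Measure Ω) (m : MeasurableSpace Ω)
    (A : Set Ω) : Ω → ℝ :=
  P[Set.indicator A (fun _ => (1 : ℝ)) | m]

/-- Weak convergence of the filtrations `Fn` to `F` : for every `A ∈ F T`, càdlàg
versions of the martingales `t ↦ E[1_A | Fn n t]` converge in probability, for the
Skorokhod topology, to a càdlàg version of `t ↦ E[1_A | F t]`. -/
def WeaklyTendstoFilt {Ω : Type*} [MeasurableSpace Ω] (P : Measure Ω) (T : ℝ)
    (Fn : ℕ → ℝ → MeasurableSpace Ω) (F : ℝ → MeasurableSpace Ω) : Prop :=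
  ∀ A : Set Ω, MeasurableSet[F T] A →
    ∃ (Mn : ℕ → ℝ → Ω → ℝ) (M : ℝ → Ω → ℝ),
      (∀ n, ∀ t ∈ Set.Icc (0 : ℝ) T, Mn n t =ᵐ[P] cev P (Fn n t) A) ∧
      (∀ t ∈ Set.Icc (0 : ℝ) T, M t =ᵐ[P] cev P (F t) A) ∧
      (∀ n ω, IsCadlagOn T (fun t => Mn n t ω)) ∧
      (∀ ω, IsCadlagOn T (fun t => M t ω)) ∧
      SkorokhodTendstoP P T Mn M

/-- The product of `P` with Lebesgue measure on `[0,1]`, on `Ω × ℝ` (modelling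
`Ω × [0,1]`). -/
def prodLeb {Ω : Type*} [MeasurableSpace Ω] (P : Measure Ω) : Measure (Ω × ℝ) :=
  P.prod ((volume : Measure ℝ).restrict (Set.Icc 0 1))

/-- The successor of `x` in the finite set `s` (and `x` itself if there is none). -/
def nextPt (s : Finset ℝ) (x : ℝ) : ℝ :=
  WithTop.untopD x (Finset.min (s.filter (fun y => x < y)))

end


/-- `t` is a time at which `X` is almost surely continuous. -/
def GoodTime {Ω : Type*} [MeasurableSpace Ω] (P : Measure Ω) (T : ℝ) (X : ℝ → Ω → ℝ)
    (t : ℝ) : Prop :=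
  ∀ᵐ ω ∂P, ContinuousWithinAt (fun s => X s ω) (Set.Icc 0 T) t

theorem cadlag_continuousWithinAt {T : ℝ} {f : ℝ → ℝ} (hf : IsCadlagOn T f) {t : ℝ}
    (ht : t ∈ Set.Icc 0 T) (hj : 0 < t → pathJump f t = 0) :
    ContinuousWithinAt f (Set.Icc 0 T) t := by
  have h1 : ContinuousWithinAt f (Set.Icc 0 T ∩ Set.Iio t) t := by
    rcases ht.1.eq_or_lt with h0 | h0
    · have : Set.Icc 0 T ∩ Set.Iio t = ∅ := by
        ext x; simp only [mem_inter_iff, mem_Icc, mem_Iio, mem_empty_iff_false]; grind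
      rw [this]; simp [ContinuousWithinAt]
    · have h2 := _root_.tendsto_leftLim_of_tendsto (hf.2 t ⟨h0, ht.2⟩)
      have h3 := hj h0
      unfold pathJump at h3
      rw [← sub_eq_zero.1 h3] at h2
      exact h2.mono_left (nhdsWithin_mono _ inter_subset_right)
  have h2 : ContinuousWithinAt f (Set.Icc 0 T ∩ Set.Ioi t) t := by
    rcases ht.2.eq_or_lt with h0 | h0
    · have : Set.Icc 0 T ∩ Set.Ioi t = ∅ := by
        ext x; simp only [mem_inter_iff, mem_Icc, mem_Ioi, mem_empty_iff_false]; grind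
      rw [this]; simp [ContinuousWithinAt]
    · exact (hf.1 t ⟨ht.1, h0⟩).mono_left (nhdsWithin_mono _ inter_subset_right)
  have h3 := ((h1.union h2).union (continuousWithinAt_singleton (f := f) (x := t)))
  refine h3.mono ?_
  intro x hx
  rcases lt_trichotomy x t with h | h | h
  · exact Or.inl (Or.inl ⟨hx, h⟩)
  · exact Or.inr h
  · exact Or.inl (Or.inr ⟨hx, h⟩)

theorem goodTime_tendstoInMeasure {Ω : Type*} [MeasurableSpace Ω] (P : Measure Ω)
    [IsProbabilityMeasure P] {T : ℝ} (hT : 0 < T) {X : ℝ → Ω → ℝ} {Xn : ℕ → ℝ → Ω → ℝ}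
    (hXnm : ∀ n, ∀ s : ℝ, Measurable (Xn n s))
    (hconv : SkorokhodTendstoP P T Xn X) {t : ℝ} (ht : t ∈ Set.Icc 0 T)
    (hg : GoodTime P T X t) : TendstoInMeasure P (fun n => Xn n t) atTop (X t) := by
  obtain ⟨Λ, hc, hm, h0, hTT, -, h1, h2⟩ := hconv
  have hs : ∀ n ω, ∃ s ∈ Set.Icc 0 T, Λ n ω s = t := by
    intro n ω
    have := intermediate_value_Icc hT.le (hc n ω)
    rw [h0, hTT] at this
    exact this ht
  choose s hsm hst using hs
  have a1 : TendstoInMeasure P (fun n ω => Xn n t ω - X (s n ω) ω) atTop (fun _ => (0 : ℝ)) := by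
    rw [tendstoInMeasure_iff_norm]
    intro ε hε
    refine tendsto_of_tendsto_of_tendsto_of_le_of_le tendsto_const_nhds (h1 ε hε)
      (fun _ => zero_le) (fun n => measure_mono ?_)
    intro ω hω
    refine ⟨s n ω, hsm n ω, ?_⟩
    rw [hst]; simpa using hω
  have a2 : TendstoInMeasure P (fun n ω => s n ω) atTop (fun _ => t) := by
    rw [tendstoInMeasure_iff_norm]
    intro ε hε
    refine tendsto_of_tendsto_of_tendsto_of_le_of_le tendsto_const_nhds (h2 ε hε)
      (fun _ => zero_le) (fun n => measure_mono ?_)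
    intro ω hω
    refine ⟨s n ω, hsm n ω, ?_⟩
    rw [hst, abs_sub_comm]; simpa using hω
  rw [exists_seq_tendstoInMeasure_atTop_iff (fun n => (hXnm n t).aestronglyMeasurable)]
  intro ns hns
  obtain ⟨n1, hn1, b1⟩ := (a1.comp hns.tendsto_atTop).exists_seq_tendsto_ae
  obtain ⟨n2, hn2, b2⟩ :=
    (a2.comp (hns.tendsto_atTop.comp hn1.tendsto_atTop)).exists_seq_tendsto_ae
  refine ⟨n1 ∘ n2, hn1.comp hn2, ?_⟩
  filter_upwards [b1, b2, hg] with ω c1 c2 c3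
  have c4 := c1.comp hn2.tendsto_atTop
  have c5 : Tendsto (fun i => X (s (ns (n1 (n2 i))) ω) ω) atTop (𝓝 (X t ω)) := by
    refine c3.tendsto.comp (tendsto_nhdsWithin_iff.2 ⟨c2, ?_⟩)
    exact Eventually.of_forall fun i => hsm _ _
  have := c4.add c5
  simp only [zero_add] at this
  refine this.congr fun i => ?_
  simp

theorem integral_tendsto_of_tendstoInMeasure {Ω : Type*} [MeasurableSpace Ω] (P : Measure Ω)
    [IsProbabilityMeasure P] {f : ℕ → Ω → ℝ} {f0 : Ω → ℝ} (hf : ∀ n, Measurable (f n))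
    (hf0 : Measurable f0)
    (h : TendstoInMeasure P f atTop f0) {g : ℝ → ℝ} (hg : Continuous g) {C : ℝ}
    (hC : ∀ x, |g x| ≤ C) :
    Tendsto (fun n => ∫ ω, |g (f n ω) - g (f0 ω)| ∂P) atTop (𝓝 0) := by
  refine tendsto_of_subseq_tendsto fun ns hns => ?_
  obtain ⟨n1, hn1, b1⟩ := (h.comp hns).exists_seq_tendsto_ae
  refine ⟨n1, ?_⟩
  have : ∫ ω, (0 : ℝ) ∂P = 0 := by simp
  rw [← this]
  refine tendsto_integral_of_dominated_convergence (fun _ => C + C) ?_ (integrable_const _) ?_ ?_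
  · intro n
    exact ((hg.measurable.comp (hf _)).sub (hg.measurable.comp hf0)).abs.aestronglyMeasurable
  · intro n
    refine Eventually.of_forall fun ω => ?_
    rw [Real.norm_eq_abs, abs_abs]
    exact (abs_sub _ _).trans (add_le_add (hC _) (hC _))
  · filter_upwards [b1] with ω hω
    have h1 := ((hg.tendsto _).comp hω).sub_const (g (f0 ω))
    simpa using h1.abs

theorem goodTime_bad_countable {Ω : Type*} [MeasurableSpace Ω] (P : Measure Ω)
    [IsProbabilityMeasure P] {T : ℝ} {X : ℝ → Ω → ℝ}
    (hXm : ∀ s : ℝ, Measurable (X s))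
    (hXcad : ∀ ω, IsCadlagOn T (fun t => X t ω)) :
    {t | t ∈ Set.Ioc 0 T ∧ ¬ GoodTime P T X t}.Countable := by
  set J : ℝ → Ω → ℝ := fun t ω => min 1 |pathJump (fun s => X s ω) t| with hJ
  have hLL : ∀ t ∈ Set.Ioc 0 T, ∀ ω, Tendsto (fun s => X s ω) (𝓝[<] t)
      (𝓝 (Function.leftLim (fun s => X s ω) t)) := fun t ht ω =>
    _root_.tendsto_leftLim_of_tendsto ((hXcad ω).2 t ht)
  have hJm : ∀ t ∈ Set.Ioc 0 T, Measurable (J t) := by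
    intro t ht
    have h1 : Measurable (fun ω => Function.leftLim (fun s => X s ω) t) :=
      measurable_of_tendsto_metrizable' (𝓝[<] t) (f := fun s => X s) hXm
        (tendsto_pi_nhds.2 fun ω => hLL t ht ω)
    exact measurable_const.min ((hXm t).sub h1).abs
  have hJ0 : ∀ t ω, 0 ≤ J t ω := fun t ω => le_min zero_le_one (abs_nonneg _)
  have hJ1 : ∀ t ω, ‖J t ω‖ ≤ 1 := fun t ω => by
    rw [Real.norm_eq_abs, abs_of_nonneg (hJ0 t ω)]; exact min_le_left _ _
  have hJi : ∀ t ∈ Set.Ioc 0 T, Integrable (J t) P := fun t ht =>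
    Integrable.of_bound (hJm t ht).aestronglyMeasurable 1 (Eventually.of_forall (hJ1 t))
  have hnear : ∀ t ∈ Set.Ioc 0 T, ∀ᶠ s in 𝓝[<] t, s ∈ Set.Ioo 0 t := fun t ht =>
    Ioo_mem_nhdsLT ht.1
  have hlim : ∀ t ∈ Set.Ioc 0 T, Tendsto (fun s => ∫ ω, J s ω ∂P) (𝓝[<] t) (𝓝 0) := by
    intro t ht
    have : ∫ ω, (0 : ℝ) ∂P = 0 := by simp
    rw [← this]
    refine tendsto_integral_filter_of_dominated_convergence (fun _ => (1 : ℝ)) ?_ ?_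
      (integrable_const _) ?_
    · filter_upwards [hnear t ht] with s hs
      exact (hJm s ⟨hs.1, hs.2.le.trans ht.2⟩).aestronglyMeasurable
    · exact Eventually.of_forall fun s => Eventually.of_forall (hJ1 s)
    · refine Eventually.of_forall fun ω => ?_
      set l := Function.leftLim (fun s => X s ω) t
      have h1 := hLL t ht ω
      rw [Metric.tendsto_nhds]
      intro ε hε
      have h2 := Metric.tendsto_nhds.1 h1 (ε / 3) (by positivity)
      obtain ⟨u, hu, hsub⟩ := (mem_nhdsLT_iff_exists_Ioo_subset).1 (h2.and (hnear t ht))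
      filter_upwards [Ioo_mem_nhdsLT hu] with s hs
      have hs0 := (hsub hs).2
      have hsl := (hsub hs).1
      have h3 := hLL s ⟨hs0.1, hs0.2.le.trans ht.2⟩ ω
      have h4 : dist (Function.leftLim (fun s => X s ω) s) l ≤ ε / 3 := by
        refine le_of_tendsto (h3.dist tendsto_const_nhds) ?_
        filter_upwards [Ioo_mem_nhdsLT hs.1] with r hr
        exact le_of_lt (hsub ⟨hr.1, hr.2.trans hs.2⟩).1
      rw [Real.dist_eq] at *
      rw [sub_zero, abs_of_nonneg (hJ0 s ω)]
      refine (min_le_right _ _).trans_lt ?_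
      unfold pathJump

      change |X s ω - l| < ε / 3 at hsl
      rw [abs_lt] at hsl
      rw [abs_le] at h4
      rw [abs_lt]
      constructor <;> linarith [hsl.1, hsl.2, h4.1, h4.2]
  have hcount : ∀ n : ℕ, {t | t ∈ Set.Ioc 0 T ∧ 1 / ((n : ℝ) + 1) ≤ ∫ ω, J t ω ∂P}.Countable := by
    intro n
    set D := {t | t ∈ Set.Ioc 0 T ∧ 1 / ((n : ℝ) + 1) ≤ ∫ ω, J t ω ∂P}
    refine (countable_setOfPred_isolated_left_within (s := D)).mono ?_
    intro t ht
    refine ⟨ht, ?_⟩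
    have h1 := (hlim t ht.1).eventually_lt_const (show (0 : ℝ) < 1 / ((n : ℝ) + 1) by positivity)
    rw [← empty_mem_iff_bot]
    have h2 : ∀ᶠ s in 𝓝[D ∩ Iio t] t, False := by
      filter_upwards [h1.filter_mono (nhdsWithin_mono _ inter_subset_right),
        self_mem_nhdsWithin] with s hs hs2
      exact absurd hs2.1.2 (not_le.2 hs)
    exact h2
  refine (countable_iUnion hcount).mono ?_
  rintro t ⟨ht, hbad⟩
  rw [mem_iUnion]
  have hpos : 0 < ∫ ω, J t ω ∂P := by
    refine lt_of_le_of_ne (integral_nonneg (hJ0 t)) fun h => hbad ?_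
    have h1 := (integral_eq_zero_iff_of_nonneg (hJ0 t) (hJi t ht)).1 h.symm
    filter_upwards [h1] with ω hω
    refine cadlag_continuousWithinAt (hXcad ω) ⟨ht.1.le, ht.2⟩ fun _ => ?_
    have hω' : min 1 |pathJump (fun s => X s ω) t| = 0 := hω
    by_contra hne
    have := lt_min one_pos (abs_pos.2 hne)
    rw [hω'] at this
    exact lt_irrefl _ this
  obtain ⟨n, hn⟩ := exists_nat_one_div_lt hpos
  exact ⟨n, ht, hn.le⟩

theorem goodTime_exists_between {Ω : Type*} [MeasurableSpace Ω] (P : Measure Ω)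
    [IsProbabilityMeasure P] {T : ℝ} {X : ℝ → Ω → ℝ}
    (hXm : ∀ s : ℝ, Measurable (X s))
    (hXcad : ∀ ω, IsCadlagOn T (fun t => X t ω)) {a b : ℝ} (ha : 0 ≤ a) (hab : a < b)
    (hb : b ≤ T) : ∃ t ∈ Set.Ioo a b, GoodTime P T X t := by
  have h := (goodTime_bad_countable P hXm hXcad).dense_compl ℝ
  obtain ⟨t, ht, ht2⟩ := h.exists_between hab
  refine ⟨t, ht2, ?_⟩
  by_contra hbad
  exact ht ⟨⟨ha.trans_lt ht2.1, ht2.2.le.trans hb⟩, hbad⟩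

theorem natFilt_measurable {Ω : Type*} (X : ℝ → Ω → ℝ) {s t : ℝ} (hs : s ∈ Set.Icc 0 t) :
    Measurable[natFilt X t] (X s) := by
  have h : MeasurableSpace.comap (X s) (borel ℝ) ≤ natFilt X t :=
    le_iSup₂_of_le (f := fun s (_ : s ∈ Set.Icc (0 : ℝ) t) =>
      MeasurableSpace.comap (X s) (borel ℝ)) s hs le_rfl
  rw [← BorelSpace.measurable_eq (α := ℝ)] at h
  exact measurable_iff_comap_le.2 h

theorem natFilt_le {Ω : Type*} (X : ℝ → Ω → ℝ)
    (t : ℝ) (m' : MeasurableSpace Ω) (hX : ∀ s ∈ Set.Icc 0 t, Measurable[m'] (X s)) :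
    natFilt X t ≤ m' := by
  refine iSup₂_le fun s hs => ?_
  rw [← BorelSpace.measurable_eq (α := ℝ)]
  exact measurable_iff_comap_le.1 (hX s hs)

theorem natFilt_mono {Ω : Type*} (X : ℝ → Ω → ℝ) {s t : ℝ} (h : s ≤ t) :
    natFilt X s ≤ natFilt X t :=
  biSup_mono fun _ hr => ⟨hr.1, hr.2.trans h⟩

/-- Events asymptotically approximable by events of the σ-fields `G n`. -/
def IsApprox {Ω : Type*} [MeasurableSpace Ω] (P : Measure Ω) (G : ℕ → MeasurableSpace Ω)
    (A : Set Ω) : Prop :=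
  ∀ ε : ENNReal, 0 < ε → ∀ᶠ n in atTop, ∃ B, MeasurableSet[G n] B ∧ P (symmDiff A B) ≤ ε

theorem isApprox_iUnion {Ω : Type*} [MeasurableSpace Ω] (P : Measure Ω) [IsProbabilityMeasure P]
    (G : ℕ → MeasurableSpace Ω) (A : ℕ → Set Ω) (hm : ∀ i, MeasurableSet (A i))
    (hA : ∀ i, IsApprox P G (A i)) : IsApprox P G (⋃ i, A i) := by
  intro ε hε
  have hε2 : 0 < ε / 2 := ENNReal.half_pos hε.ne'
  set D : ℕ → Set Ω := fun K => (⋃ i, A i) \ ⋃ i ∈ Finset.range K, A i with hD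
  have hDm : ∀ K, MeasurableSet (D K) := fun K =>
    MeasurableSet.diff (MeasurableSet.iUnion hm) (Finset.measurableSet_biUnion _ fun i _ => hm i)
  have hDa : Antitone D := by
    intro K K' h
    refine sdiff_subset_sdiff_right ?_
    refine biUnion_subset_biUnion_left ?_
    intro i hi
    simp only [Finset.coe_range, mem_Iio, Finset.mem_range] at *
    exact lt_of_lt_of_le hi h
  have hDi : ⋂ K, D K = ∅ := by
    ext ω
    simp only [hD, mem_iInter, Set.mem_sdiff, mem_iUnion, mem_empty_iff_false, iff_false, not_forall]
    by_cases h : ∃ i, ω ∈ A i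
    · obtain ⟨i, hi⟩ := h
      exact ⟨i + 1, fun h => h.2 ⟨i, by simp, hi⟩⟩
    · exact ⟨0, fun h' => h h'.1⟩
  have hlim : Tendsto (fun K => P (D K)) atTop (𝓝 0) := by
    have := tendsto_measure_iInter_atTop (μ := P) (fun K => (hDm K).nullMeasurableSet) hDa
      ⟨0, measure_ne_top _ _⟩
    rwa [hDi, measure_empty] at this
  obtain ⟨K, hK⟩ := (hlim.eventually_lt_const hε2).exists
  obtain ⟨e, he, hes⟩ := ENNReal.exists_pos_sum_of_countable hε2.ne' ℕ
  have hev : ∀ᶠ n in atTop, ∀ i ∈ Finset.range K, ∃ B, MeasurableSet[G n] B ∧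
      P (symmDiff (A i) B) ≤ e i := by
    rw [Filter.eventually_all_finset]
    exact fun i _ => hA i (e i) (by exact_mod_cast he i)
  filter_upwards [hev] with n hn
  have hn' : ∀ i, ∃ B, i ∈ Finset.range K → (MeasurableSet[G n] B ∧ P (symmDiff (A i) B) ≤ e i) := by
    intro i
    by_cases hi : i ∈ Finset.range K
    · obtain ⟨B, hB⟩ := hn i hi; exact ⟨B, fun _ => hB⟩
    · exact ⟨∅, fun h => absurd h hi⟩
  choose B hB using hn'
  refine ⟨⋃ i ∈ Finset.range K, B i, ?_, ?_⟩
  · exact @Finset.measurableSet_biUnion _ _ (G n) _ _ fun i hi => (hB i hi).1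
  have hsub : symmDiff (⋃ i, A i) (⋃ i ∈ Finset.range K, B i) ⊆
      D K ∪ ⋃ i ∈ Finset.range K, symmDiff (A i) (B i) := by
    intro ω hω
    clear hDm hDa hDi hlim hK
    simp only [hD, mem_symmDiff, mem_union, Set.mem_sdiff, mem_iUnion] at *
    grind
  calc P _ ≤ P (D K) + P (⋃ i ∈ Finset.range K, symmDiff (A i) (B i)) :=
        (measure_mono hsub).trans (measure_union_le _ _)
    _ ≤ ε / 2 + ∑ i ∈ Finset.range K, P (symmDiff (A i) (B i)) :=
        add_le_add hK.le (measure_biUnion_finset_le _ _)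
    _ ≤ ε / 2 + ∑ i ∈ Finset.range K, (e i : ENNReal) := by
        gcongr with i hi; exact (hB i hi).2
    _ ≤ ε / 2 + ε / 2 := by
        gcongr; exact (ENNReal.sum_le_tsum _).trans hes.le
    _ = ε := ENNReal.add_halves ε

/-- The σ-field of approximable events. -/
@[reducible] def approxSpace {Ω : Type*} [MeasurableSpace Ω] (P : Measure Ω) [IsProbabilityMeasure P]
    (G : ℕ → MeasurableSpace Ω) : MeasurableSpace Ω where
  MeasurableSet' A := MeasurableSet A ∧ IsApprox P G A
  measurableSet_empty := ⟨MeasurableSet.empty, fun ε _ => Eventually.of_forall fun n =>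
    ⟨∅, @MeasurableSet.empty _ (G n), by simp⟩⟩
  measurableSet_compl A hA := ⟨hA.1.compl, fun ε hε => by
    filter_upwards [hA.2 ε hε] with n hn
    obtain ⟨B, hB, hB2⟩ := hn
    refine ⟨Bᶜ, hB.compl, ?_⟩
    rwa [compl_symmDiff_compl]⟩
  measurableSet_iUnion A hA := ⟨MeasurableSet.iUnion fun i => (hA i).1,
    isApprox_iUnion P G A (fun i => (hA i).1) fun i => (hA i).2⟩

theorem approx_of_tendstoInMeasure {Ω : Type*} [MeasurableSpace Ω] (P : Measure Ω)
    [IsProbabilityMeasure P] (G : ℕ → MeasurableSpace Ω) {f : ℕ → Ω → ℝ} {f0 : Ω → ℝ}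
    (hfG : ∀ n, Measurable[G n] (f n)) (hf0 : Measurable f0)
    (h : TendstoInMeasure P f atTop f0) : Measurable[approxSpace P G] f0 := by
  refine @measurable_of_Ioi ℝ Ω _ _ _ (approxSpace P G) _ _ _ _ fun c => ?_
  refine ⟨hf0 measurableSet_Ioi, ?_⟩
  intro ε hε
  have hε2 : 0 < ε / 2 := ENNReal.half_pos hε.ne'
  set D : ℕ → Set Ω := fun k => f0 ⁻¹' Set.Ioc c (c + 2 * (1 / ((k : ℝ) + 1))) with hD
  have hDm : ∀ K, MeasurableSet (D K) := fun K => hf0 measurableSet_Ioc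
  have hDa : Antitone D := by
    intro K K' h
    refine preimage_mono (Ioc_subset_Ioc_right ?_)
    have := Nat.one_div_le_one_div (α := ℝ) h
    linarith
  have hDi : ⋂ K, D K = ∅ := by
    ext ω
    simp only [hD, mem_iInter, mem_preimage, mem_Ioc, mem_empty_iff_false, iff_false, not_forall]
    by_cases h : c < f0 ω
    · obtain ⟨k, hk⟩ := exists_nat_one_div_lt (show (0 : ℝ) < (f0 ω - c) / 2 by linarith)
      exact ⟨k, fun h => by linarith [h.2]⟩
    · exact ⟨0, fun h' => h h'.1⟩
  have hlim : Tendsto (fun K => P (D K)) atTop (𝓝 0) := by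
    have := tendsto_measure_iInter_atTop (μ := P) (fun K => (hDm K).nullMeasurableSet) hDa
      ⟨0, measure_ne_top _ _⟩
    rwa [hDi, measure_empty] at this
  obtain ⟨k, hk⟩ := (hlim.eventually_lt_const hε2).exists
  set δ : ℝ := 1 / ((k : ℝ) + 1) with hδ
  have hδ0 : 0 < δ := by positivity
  have h1 := (tendstoInMeasure_iff_norm.1 h δ hδ0).eventually_lt_const hε2
  filter_upwards [h1] with n hn
  refine ⟨f n ⁻¹' Set.Ioi (c + δ), hfG n measurableSet_Ioi, ?_⟩
  have hsub : symmDiff (f0 ⁻¹' Set.Ioi c) (f n ⁻¹' Set.Ioi (c + δ)) ⊆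
      D k ∪ {ω | δ ≤ ‖f n ω - f0 ω‖} := by
    intro ω hω
    change (f0 ω ∈ Set.Ioc c (c + 2 * δ)) ∨ δ ≤ |f n ω - f0 ω|
    rcases hω with ⟨h1, h2⟩ | ⟨h1, h2⟩
    · have h1' : c < f0 ω := h1
      have h2' : f n ω ≤ c + δ := not_lt.1 h2
      by_cases h3 : f0 ω ≤ c + 2 * δ
      · exact Or.inl ⟨h1', h3⟩
      · right; rw [abs_sub_comm]; exact le_trans (by linarith) (le_abs_self _)
    · have h1' : c + δ < f n ω := h1
      have h2' : f0 ω ≤ c := not_lt.1 h2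
      right; exact le_trans (by linarith) (le_abs_self _)
  calc P _ ≤ P (D k) + P {ω | δ ≤ ‖f n ω - f0 ω‖} :=
        (measure_mono hsub).trans (measure_union_le _ _)
    _ ≤ ε / 2 + ε / 2 := add_le_add hk.le hn.le
    _ = ε := ENNReal.add_halves ε

theorem natFilt_le_approx {Ω : Type*} [MeasurableSpace Ω] (P : Measure Ω)
    [IsProbabilityMeasure P] {T : ℝ} (hT : 0 < T) {X : ℝ → Ω → ℝ} {Xn : ℕ → ℝ → Ω → ℝ}
    (hXm : ∀ s : ℝ, Measurable (X s)) (hXnm : ∀ n, ∀ s : ℝ, Measurable (Xn n s))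
    (hXcad : ∀ ω, IsCadlagOn T (fun t => X t ω))
    (hconv : SkorokhodTendstoP P T Xn X) {t : ℝ} (ht : t ∈ Set.Icc 0 T)
    (hg : GoodTime P T X t) :
    natFilt X t ≤ approxSpace P (fun n => natFilt (Xn n) t) := by
  have key : ∀ s ∈ Set.Icc 0 t, GoodTime P T X s →
      Measurable[approxSpace P (fun n => natFilt (Xn n) t)] (X s) := fun s hs hgs =>
    approx_of_tendstoInMeasure P _ (fun n => natFilt_measurable (Xn n) hs) (hXm s)
      (goodTime_tendstoInMeasure P hT hXnm hconv ⟨hs.1, hs.2.trans ht.2⟩ hgs)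
  refine natFilt_le X t _ fun s hs => ?_
  rcases hs.2.eq_or_lt with h | h
  · rw [h]; exact key t ⟨ht.1, le_rfl⟩ hg
  · have hex : ∀ k : ℕ, ∃ r ∈ Set.Ioo s (min t (s + 1 / ((k : ℝ) + 1))), GoodTime P T X r := by
      intro k
      refine goodTime_exists_between P hXm hXcad hs.1 (lt_min h ?_) ((min_le_left _ _).trans ht.2)
      have : (0 : ℝ) < 1 / ((k : ℝ) + 1) := by positivity
      linarith
    choose r hr hgr using hex
    have hrlim : Tendsto r atTop (𝓝[>] s) := by
      refine tendsto_nhdsWithin_iff.2 ⟨?_, Eventually.of_forall fun k => (hr k).1⟩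
      have h2 : Tendsto (fun k : ℕ => s + 1 / ((k : ℝ) + 1)) atTop (𝓝 s) := by
        simpa using tendsto_one_div_add_atTop_nhds_zero_nat.const_add s
      exact tendsto_of_tendsto_of_tendsto_of_le_of_le tendsto_const_nhds h2
        (fun k => (hr k).1.le) (fun k => (hr k).2.le.trans (min_le_right _ _))
    refine @measurable_of_tendsto_metrizable _ _ (approxSpace P (fun n => natFilt (Xn n) t))
      _ _ _ _ (fun k => X (r k)) _ (fun k => key _ ⟨hs.1.trans (hr k).1.le,
        (hr k).2.le.trans (min_le_left _ _)⟩ (hgr k)) (tendsto_pi_nhds.2 fun ω => ?_)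
    exact ((hXcad ω).1 s ⟨hs.1, h.trans_le ht.2⟩).comp hrlim

open Classical in
/-- The first point of `S` satisfying `p` (capped at `L`). -/
noncomputable def firstPt (S : Finset ℝ) (L : ℝ) (p : ℝ → Prop) : ℝ :=
  (insert L (S.filter p)).min' ⟨L, Finset.mem_insert_self _ _⟩

theorem firstPt_le (S : Finset ℝ) (L : ℝ) (p : ℝ → Prop) : firstPt S L p ≤ L :=
  Finset.min'_le _ _ (Finset.mem_insert_self _ _)

theorem firstPt_le_of_mem {S : Finset ℝ} (L : ℝ) {p : ℝ → Prop} {y : ℝ} (hy : y ∈ S)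
    (hp : p y) : firstPt S L p ≤ y := by
  classical
  exact Finset.min'_le _ _ (Finset.mem_insert_of_mem (Finset.mem_filter.2 ⟨hy, hp⟩))

theorem firstPt_cases (S : Finset ℝ) (L : ℝ) (p : ℝ → Prop) :
    firstPt S L p = L ∨ (firstPt S L p ∈ S ∧ p (firstPt S L p)) := by
  classical
  have h := Finset.min'_mem (insert L (S.filter p)) ⟨L, Finset.mem_insert_self _ _⟩
  rcases Finset.mem_insert.1 h with h | h
  · left; exact h
  · right; exact Finset.mem_filter.1 h

theorem firstPt_mem (S : Finset ℝ) (L : ℝ) (p : ℝ → Prop) : firstPt S L p ∈ insert L S := by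
  rcases firstPt_cases S L p with h | h
  · rw [h]; exact Finset.mem_insert_self _ _
  · exact Finset.mem_insert_of_mem h.1

theorem firstPt_le_iff {S : Finset ℝ} {L : ℝ} {p : ℝ → Prop} {t : ℝ} (ht : t < L) :
    firstPt S L p ≤ t ↔ ∃ y ∈ S, y ≤ t ∧ p y := by
  constructor
  · intro h
    rcases firstPt_cases S L p with h1 | h1
    · rw [h1] at h; exact absurd h (not_le.2 ht)
    · exact ⟨_, h1.1, h, h1.2⟩
  · rintro ⟨y, hy, hyt, hp⟩
    exact (firstPt_le_of_mem L hy hp).trans hyt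

theorem firstPt_congr {S : Finset ℝ} {L : ℝ} {p q : ℝ → Prop} (h : ∀ y ∈ S, p y ↔ q y) :
    firstPt S L p = firstPt S L q := by
  classical
  unfold firstPt
  congr 2
  convert Finset.filter_congr h

theorem firstPt_stopping {Ω : Type*} (X : ℝ → Ω → ℝ) {S : Finset ℝ} {L : ℝ}
    {B : ℝ → Set Ω} (hB : ∀ y ∈ S, MeasurableSet[natFilt X y] (B y)) :
    IsStoppingTimeOn (natFilt X) (fun ω => firstPt S L (fun y => ω ∈ B y)) := by
  intro t
  rcases lt_or_ge t L with ht | ht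
  · have : {ω | firstPt S L (fun y => ω ∈ B y) ≤ t} = ⋃ y ∈ S.filter (· ≤ t), B y := by
      ext ω
      rw [mem_iUnion₂]
      refine (firstPt_le_iff ht).trans ?_
      simp only [Finset.mem_filter, exists_prop, and_assoc]
    rw [this]
    refine @Finset.measurableSet_biUnion _ _ (natFilt X t) _ _ fun y hy => ?_
    have := Finset.mem_filter.1 hy
    exact natFilt_mono X this.2 _ (hB y this.1)
  · have : {ω | firstPt S L (fun y => ω ∈ B y) ≤ t} = univ :=
      eq_univ_of_forall fun ω => (firstPt_le _ _ _).trans ht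
    rw [this]
    exact @MeasurableSet.univ _ (natFilt X t)

theorem stopping_measurable {Ω : Type*} [MeasurableSpace Ω] {X : ℝ → Ω → ℝ}
    (hXm : ∀ s : ℝ, Measurable (X s)) {τ : Ω → ℝ} (h : IsStoppingTimeOn (natFilt X) τ) :
    Measurable τ := by
  refine measurable_of_Iic fun t => ?_
  exact natFilt_le X t _ (fun s _ => hXm s) _ (h t)

theorem measurable_finite_eval {Ω : Type*} [MeasurableSpace Ω] {f : ℝ → Ω → ℝ} {S : Finset ℝ}
    (hf : ∀ y ∈ S, Measurable (f y)) {σ : Ω → ℝ} (hσ : Measurable σ) (hS : ∀ ω, σ ω ∈ S) :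
    Measurable (fun ω => f (σ ω) ω) := by
  have : (fun ω => f (σ ω) ω) = fun ω => ∑ y ∈ S, (σ ⁻¹' {y}).indicator (f y) ω := by
    ext ω
    rw [Finset.sum_eq_single (σ ω)]
    · simp
    · intro y _ hy
      rw [indicator_of_notMem]
      intro h; exact hy h.symm
    · intro h; exact absurd (hS ω) h
  rw [this]
  exact Finset.measurable_sum _ fun y hy => (hf y hy).indicator (hσ (measurableSet_singleton y))

theorem optValue_ge {Ω : Type*} [MeasurableSpace Ω] (P : Measure Ω) [IsProbabilityMeasure P]
    {γ : ℝ → ℝ → ℝ} {C : ℝ} (hC : ∀ t ∈ Set.Ici (0 : ℝ), ∀ y : ℝ, |γ t y| ≤ C)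
    (X : ℝ → Ω → ℝ) {L : ℝ} {τ : Ω → ℝ} (h : IsStoppingTimeOn (natFilt X) τ)
    (hτ : ∀ ω, τ ω ∈ Set.Icc 0 L) :
    ∫ ω, γ (τ ω) (X (τ ω) ω) ∂P ≤ optValue P (natFilt X) X γ L := by
  refine le_csSup ⟨C, ?_⟩ ⟨τ, h, hτ, rfl⟩
  rintro x ⟨σ, -, hσ, rfl⟩
  have := norm_integral_le_of_norm_le_const (μ := P) (f := fun ω => γ (σ ω) (X (σ ω) ω))
    (Eventually.of_forall fun ω => hC _ (hσ ω).1 _)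
  simp only [probReal_univ, mul_one] at this
  exact (le_abs_self _).trans this

theorem zero_stopping {Ω : Type*} (X : ℝ → Ω → ℝ) :
    IsStoppingTimeOn (natFilt X) (fun _ => 0) := by
  intro t
  exact @MeasurableSet.const _ (natFilt X t) _

theorem optValue_le {Ω : Type*} [MeasurableSpace Ω] (P : Measure Ω) [IsProbabilityMeasure P]
    {γ : ℝ → ℝ → ℝ} {C : ℝ} (hC : ∀ t ∈ Set.Ici (0 : ℝ), ∀ y : ℝ, |γ t y| ≤ C)
    (X : ℝ → Ω → ℝ) {L : ℝ} (hL : 0 ≤ L) : optValue P (natFilt X) X γ L ≤ C := by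
  refine csSup_le ⟨_, fun _ => 0, zero_stopping X, fun _ => ⟨le_rfl, hL⟩, rfl⟩ ?_
  rintro x ⟨σ, -, hσ, rfl⟩
  have := norm_integral_le_of_norm_le_const (μ := P) (f := fun ω => γ (σ ω) (X (σ ω) ω))
    (Eventually.of_forall fun ω => hC _ (hσ ω).1 _)
  simp only [probReal_univ, mul_one] at this
  exact (le_abs_self _).trans this

theorem discrete_le {Ω : Type*} [MeasurableSpace Ω] (P : Measure Ω) [IsProbabilityMeasure P]
    {T L : ℝ} (hT : 0 < T) (hL : L ∈ Set.Icc 0 T) {γ : ℝ → ℝ → ℝ}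
    (hγc : ∀ t, 0 ≤ t → Continuous (γ t))
    {C : ℝ} (hC : ∀ t ∈ Set.Ici (0 : ℝ), ∀ y : ℝ, |γ t y| ≤ C)
    {X : ℝ → Ω → ℝ} {Xn : ℕ → ℝ → Ω → ℝ}
    (hXm : ∀ s : ℝ, Measurable (X s)) (hXnm : ∀ n, ∀ s : ℝ, Measurable (Xn n s))
    (hXcad : ∀ ω, IsCadlagOn T (fun t => X t ω))
    (hconv : SkorokhodTendstoP P T Xn X) (hLg : GoodTime P T X L)
    {S : Finset ℝ} (hS : ∀ y ∈ S, y ∈ Set.Icc 0 L) (hSg : ∀ y ∈ S, GoodTime P T X y)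
    {A : ℝ → Set Ω} (hA : ∀ y ∈ S, MeasurableSet[natFilt X y] (A y)) {ε : ℝ} (hε : 0 < ε) :
    ∀ᶠ n in atTop, ∫ ω, γ (firstPt S L (fun y => ω ∈ A y))
        (X (firstPt S L (fun y => ω ∈ A y)) ω) ∂P - ε ≤
      optValue P (natFilt (Xn n)) (Xn n) γ L := by
  classical
  set S' := insert L S with hS'
  have hS'I : ∀ y ∈ S', y ∈ Set.Icc 0 L := by
    intro y hy
    rcases Finset.mem_insert.1 hy with rfl | h
    · exact ⟨hL.1, le_rfl⟩
    · exact hS y h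
  have hS'g : ∀ y ∈ S', GoodTime P T X y := by
    intro y hy
    rcases Finset.mem_insert.1 hy with rfl | h
    · exact hLg
    · exact hSg y h
  have hC0 : 0 ≤ C := (abs_nonneg _).trans (hC 0 (mem_Ici.2 le_rfl) 0)
  have hAm : ∀ y ∈ S, MeasurableSet (A y) := fun y hy =>
    natFilt_le X y _ (fun s _ => hXm s) _ (hA y hy)
  -- the payoffs converge
  have e1 : ∀ᶠ n in atTop,
      ∑ y ∈ S', ∫ ω, |γ y (Xn n y ω) - γ y (X y ω)| ∂P < ε / 2 := by
    have h1 : Tendsto (fun n => ∑ y ∈ S', ∫ ω, |γ y (Xn n y ω) - γ y (X y ω)| ∂P) atTop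
        (𝓝 (∑ y ∈ S', 0)) := by
      refine tendsto_finsetSum _ fun y hy => ?_
      have hyI := hS'I y hy
      exact integral_tendsto_of_tendstoInMeasure P (fun n => hXnm n y) (hXm y)
        (goodTime_tendstoInMeasure P hT hXnm hconv ⟨hyI.1, hyI.2.trans hL.2⟩ (hS'g y hy))
        (hγc y hyI.1) (hC y hyI.1)
    rw [Finset.sum_const_zero] at h1
    exact h1.eventually_lt_const (by positivity)
  set δ : ℝ := ε / 2 / ((2 * C + 1) * (S.card + 1)) with hδ
  have hδ0 : 0 < δ := by positivity
  have e2 : ∀ᶠ n in atTop, ∀ y ∈ S, ∃ B, MeasurableSet[natFilt (Xn n) y] B ∧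
      P (symmDiff (A y) B) ≤ ENNReal.ofReal δ := by
    rw [Filter.eventually_all_finset]
    intro y hy
    have hyI := hS y hy
    exact (natFilt_le_approx P hT hXm hXnm hXcad hconv ⟨hyI.1, hyI.2.trans hL.2⟩
      (hSg y hy) _ (hA y hy)).2 _ (ENNReal.ofReal_pos.2 hδ0)
  filter_upwards [e1, e2] with n hn1 hn2
  have hn2' : ∀ y, ∃ B, y ∈ S → (MeasurableSet[natFilt (Xn n) y] B ∧
      P (symmDiff (A y) B) ≤ ENNReal.ofReal δ) := by
    intro y
    by_cases hy : y ∈ S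
    · obtain ⟨B, hB⟩ := hn2 y hy; exact ⟨B, fun _ => hB⟩
    · exact ⟨∅, fun h => absurd h hy⟩
  choose B hB using hn2'
  have hBm : ∀ y ∈ S, MeasurableSet (B y) := fun y hy =>
    natFilt_le (Xn n) y _ (fun s _ => hXnm n s) _ (hB y hy).1
  set τ : Ω → ℝ := fun ω => firstPt S L (fun y => ω ∈ A y) with hτ
  set σ : Ω → ℝ := fun ω => firstPt S L (fun y => ω ∈ B y) with hσ
  have hτs : IsStoppingTimeOn (natFilt X) τ := firstPt_stopping X hA
  have hσs : IsStoppingTimeOn (natFilt (Xn n)) σ :=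
    firstPt_stopping (Xn n) fun y hy => (hB y hy).1
  have hτm : Measurable τ := stopping_measurable hXm hτs
  have hσm : Measurable σ := stopping_measurable (hXnm n) hσs
  have hτS : ∀ ω, τ ω ∈ S' := fun ω => firstPt_mem _ _ _
  have hσS : ∀ ω, σ ω ∈ S' := fun ω => firstPt_mem _ _ _
  have hm1 : Measurable (fun ω => γ (τ ω) (X (τ ω) ω)) :=
    measurable_finite_eval (f := fun y ω => γ y (X y ω))
      (fun y hy => (hγc y (hS'I y hy).1).measurable.comp (hXm y)) hτm hτS
  have hm2 : Measurable (fun ω => γ (σ ω) (Xn n (σ ω) ω)) :=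
    measurable_finite_eval (f := fun y ω => γ y (Xn n y ω))
      (fun y hy => (hγc y (hS'I y hy).1).measurable.comp (hXnm n y)) hσm hσS
  have hi1 : Integrable (fun ω => γ (τ ω) (X (τ ω) ω)) P :=
    Integrable.of_bound hm1.aestronglyMeasurable C
      (Eventually.of_forall fun ω => hC _ (hS'I _ (hτS ω)).1 _)
  have hi2 : Integrable (fun ω => γ (σ ω) (Xn n (σ ω) ω)) P :=
    Integrable.of_bound hm2.aestronglyMeasurable C
      (Eventually.of_forall fun ω => hC _ (hS'I _ (hσS ω)).1 _)
  set g : ℝ → Ω → ℝ := fun y ω => |γ y (Xn n y ω) - γ y (X y ω)| with hg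
  have hgm : ∀ y ∈ S', Measurable (g y) := fun y hy =>
    (((hγc y (hS'I y hy).1).measurable.comp (hXnm n y)).sub
      ((hγc y (hS'I y hy).1).measurable.comp (hXm y))).abs
  have hgi : ∀ y ∈ S', Integrable (g y) P := fun y hy =>
    Integrable.of_bound (hgm y hy).aestronglyMeasurable (C + C)
      (Eventually.of_forall fun ω => by
        rw [hg, Real.norm_eq_abs, abs_abs]
        exact (abs_sub _ _).trans
          (add_le_add (hC _ (hS'I y hy).1 _) (hC _ (hS'I y hy).1 _)))
  set k : ℝ → Ω → ℝ := fun y => (symmDiff (A y) (B y)).indicator (fun _ => 2 * C) with hk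
  have hsm : ∀ y ∈ S, MeasurableSet (symmDiff (A y) (B y)) := fun y hy =>
    (hAm y hy).symmDiff (hBm y hy)
  have hki : ∀ y ∈ S, Integrable (k y) P := fun y hy =>
    (integrable_const _).indicator (hsm y hy)
  have hg0 : ∀ y ω, 0 ≤ g y ω := fun y ω => abs_nonneg _
  have hk0 : ∀ y ω, 0 ≤ k y ω := fun y ω => indicator_nonneg (fun _ _ => by positivity) _
  have hpt : ∀ ω, γ (τ ω) (X (τ ω) ω) ≤ γ (σ ω) (Xn n (σ ω) ω) +
      (∑ y ∈ S', g y ω + ∑ y ∈ S, k y ω) := by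
    intro ω
    have s1 : 0 ≤ ∑ y ∈ S', g y ω := Finset.sum_nonneg fun y _ => hg0 y ω
    have s2 : 0 ≤ ∑ y ∈ S, k y ω := Finset.sum_nonneg fun y _ => hk0 y ω
    by_cases hω : ∃ y ∈ S, ω ∈ symmDiff (A y) (B y)
    · obtain ⟨y, hy, hyω⟩ := hω
      have h1 : 2 * C ≤ ∑ y ∈ S, k y ω := by
        refine le_trans (le_of_eq ?_) (Finset.single_le_sum (f := fun y => k y ω) (fun y _ => hk0 y ω) hy)
        exact (indicator_of_mem hyω (fun _ => 2 * C)).symm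
      have h2 := (abs_le.1 (hC _ (hS'I _ (hτS ω)).1 (X (τ ω) ω))).2
      have h3 := (abs_le.1 (hC _ (hS'I _ (hσS ω)).1 (Xn n (σ ω) ω))).1
      linarith
    · have heq : τ ω = σ ω := by
        refine firstPt_congr fun y hy => ?_
        have : ω ∉ symmDiff (A y) (B y) := fun h => hω ⟨y, hy, h⟩
        rw [mem_symmDiff] at this
        tauto
      have h1 : g (σ ω) ω ≤ ∑ y ∈ S', g y ω :=
        Finset.single_le_sum (f := fun y => g y ω) (fun y _ => hg0 y ω) (hσS ω)
      have h2 := (abs_le.1 (le_refl (g (σ ω) ω))).1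
      rw [heq]
      have h3 : γ (σ ω) (X (σ ω) ω) - γ (σ ω) (Xn n (σ ω) ω) ≤ g (σ ω) ω := by
        rw [hg]
        change _ ≤ |γ (σ ω) (Xn n (σ ω) ω) - γ (σ ω) (X (σ ω) ω)|
        rw [abs_sub_comm]; exact le_abs_self _
      linarith
  have hig : Integrable (fun ω => ∑ y ∈ S', g y ω) P := integrable_finsetSum _ hgi
  have hik : Integrable (fun ω => ∑ y ∈ S, k y ω) P := integrable_finsetSum _ hki
  have hint := integral_mono hi1 (hi2.add (hig.add hik)) hpt
  rw [integral_add' hi2 (hig.add hik), integral_add' hig hik, integral_finsetSum _ hgi, integral_finsetSum _ hki] at hint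
  have hkb : ∑ y ∈ S, ∫ ω, k y ω ∂P ≤ ε / 2 := by
    calc ∑ y ∈ S, ∫ ω, k y ω ∂P ≤ ∑ y ∈ S, δ * (2 * C) := by
          refine Finset.sum_le_sum fun y hy => ?_
          rw [hk, integral_indicator_const _ (hsm y hy), smul_eq_mul]
          refine mul_le_mul_of_nonneg_right ?_ (by positivity)
          exact ENNReal.toReal_le_of_le_ofReal hδ0.le (hB y hy).2
      _ = S.card * (δ * (2 * C)) := by rw [Finset.sum_const, nsmul_eq_mul]
      _ ≤ δ * ((2 * C + 1) * (S.card + 1)) := by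
          have : (0 : ℝ) ≤ S.card := by positivity
          nlinarith [mul_nonneg hδ0.le hC0, mul_nonneg hδ0.le this]
      _ = ε / 2 := by rw [hδ]; field_simp
  have hopt := optValue_ge P hC (Xn n) hσs (fun ω => hS'I _ (hσS ω))
  linarith

/-- If `Xⁿ →P X` (Skorokhod) and `P[ΔX_L ≠ 0] = 0`, then
`Γ(L) ≤ liminf Γₙ(L)`. -/
theorem value_le_liminf_values
    {Ω : Type*} [MeasurableSpace Ω] (P : Measure Ω) [IsProbabilityMeasure P]
    (T L : ℝ) (hT : 0 < T) (hL : L ∈ Set.Icc 0 T)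
    (γ : ℝ → ℝ → ℝ)
    (hγc : ContinuousOn (fun p : ℝ × ℝ => γ p.1 p.2) (Set.Ici 0 ×ˢ Set.univ))
    (hγb : ∃ C : ℝ, ∀ t ∈ Set.Ici (0 : ℝ), ∀ y : ℝ, |γ t y| ≤ C)
    (X : ℝ → Ω → ℝ) (Xn : ℕ → ℝ → Ω → ℝ)
    (hXm : ∀ s : ℝ, Measurable (X s)) (hXnm : ∀ n, ∀ s : ℝ, Measurable (Xn n s))
    (hXcad : ∀ ω, IsCadlagOn T (fun t => X t ω))
    (hXncad : ∀ n ω, IsCadlagOn T (fun t => Xn n t ω))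
    (hXL : P {ω | pathJump (fun s => X s ω) L ≠ 0} = 0)
    (hconv : SkorokhodTendstoP P T Xn X) :
    optValue P (natFilt X) X γ L ≤
      Filter.liminf (fun n => optValue P (natFilt (Xn n)) (Xn n) γ L) Filter.atTop := by
  obtain ⟨C, hC⟩ := hγb
  have hγy : ∀ t, 0 ≤ t → Continuous (γ t) := by
    intro t ht
    refine hγc.comp_continuous (f := fun y => (t, y)) (by fun_prop) fun y => ⟨ht, mem_univ _⟩
  have hLg : GoodTime P T X L := by
    have h1 : ∀ᵐ ω ∂P, pathJump (fun s => X s ω) L = 0 := by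
      rw [ae_iff]; exact hXL
    filter_upwards [h1] with ω hω
    exact cadlag_continuousWithinAt (hXcad ω) hL fun _ => hω
  refine csSup_le ⟨_, fun _ => 0, zero_stopping X, fun _ => ⟨le_rfl, hL.1⟩, rfl⟩ ?_
  rintro x ⟨τ, hτs, hτI, rfl⟩
  -- a dense sequence of good times
  obtain ⟨e, he⟩ := exists_surjective_nat (ℚ × ℚ)
  have hq : ∀ j : ℕ, ∃ r ∈ Set.Icc 0 L, GoodTime P T X r ∧
      ((0 : ℝ) ≤ (e j).1 → ((e j).1 : ℝ) < (e j).2 → ((e j).2 : ℝ) ≤ L →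
        r ∈ Set.Ioo ((e j).1 : ℝ) (e j).2) := by
    intro j
    by_cases h : (0 : ℝ) ≤ (e j).1 ∧ ((e j).1 : ℝ) < (e j).2 ∧ ((e j).2 : ℝ) ≤ L
    · obtain ⟨r, hr, hg⟩ := goodTime_exists_between P hXm hXcad h.1 h.2.1 (h.2.2.trans hL.2)
      exact ⟨r, ⟨h.1.trans hr.1.le, hr.2.le.trans h.2.2⟩, hg, fun _ _ _ => hr⟩
    · exact ⟨L, ⟨hL.1, le_rfl⟩, hLg, fun h1 h2 h3 => absurd ⟨h1, h2, h3⟩ h⟩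
  choose q hqI hqg hqb using hq
  set S : ℕ → Finset ℝ := fun k => (Finset.range k).image q with hS
  set A : ℝ → Set Ω := fun y => {ω | τ ω ≤ y} with hA
  set τk : ℕ → Ω → ℝ := fun k ω => firstPt (S k) L (fun y => ω ∈ A y) with hτk
  have hSI : ∀ k, ∀ y ∈ S k, y ∈ Set.Icc 0 L := by
    intro k y hy
    obtain ⟨j, -, rfl⟩ := Finset.mem_image.1 hy
    exact hqI j
  have hSg : ∀ k, ∀ y ∈ S k, GoodTime P T X y := by
    intro k y hy
    obtain ⟨j, -, rfl⟩ := Finset.mem_image.1 hy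
    exact hqg j
  have hτk_ge : ∀ k ω, τ ω ≤ τk k ω := by
    intro k ω
    rcases firstPt_cases (S k) L (fun y => ω ∈ A y) with h | h
    · exact (hτI ω).2.trans h.ge
    · exact h.2
  have hτk_le : ∀ k ω, τk k ω ≤ L := fun k ω => firstPt_le _ _ _
  have hτk_lim : ∀ ω, Tendsto (fun k => τk k ω) atTop (𝓝 (τ ω)) := by
    intro ω
    rcases (hτI ω).2.eq_or_lt with h | h
    · have : ∀ k, τk k ω = τ ω := fun k => le_antisymm (h ▸ hτk_le k ω) (hτk_ge k ω)
      simp only [this]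
      exact tendsto_const_nhds
    · rw [tendsto_order]
      refine ⟨fun a ha => Eventually.of_forall fun k => ha.trans_le (hτk_ge k ω), fun a ha => ?_⟩
      obtain ⟨r1, h1, h2⟩ := exists_rat_btwn (lt_min ha h)
      obtain ⟨r2, h3, h4⟩ := exists_rat_btwn h2
      obtain ⟨j, hj⟩ := he (r1, r2)
      have hb := hqb j
      rw [hj] at hb
      have hb' := hb ((hτI ω).1.trans h1.le) h3 (h4.le.trans (min_le_right _ _))
      filter_upwards [eventually_gt_atTop j] with k hk
      have hmem : q j ∈ S k := Finset.mem_image_of_mem q (Finset.mem_range.2 hk)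
      have hle : τk k ω ≤ q j :=
        firstPt_le_of_mem L hmem (show τ ω ≤ q j from h1.le.trans hb'.1.le)
      exact hle.trans_lt (hb'.2.trans (h4.trans_le (min_le_left _ _)))
  have hτk_s : ∀ k, IsStoppingTimeOn (natFilt X) (τk k) := fun k =>
    firstPt_stopping X fun y _ => hτs y
  have hXlim : ∀ ω, Tendsto (fun k => X (τk k ω) ω) atTop (𝓝 (X (τ ω) ω)) := by
    intro ω
    rcases ((hτI ω).2.trans hL.2).eq_or_lt with h | h
    · have : ∀ k, τk k ω = τ ω := fun k =>
        le_antisymm (((hτk_le k ω).trans hL.2).trans h.ge) (hτk_ge k ω)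
      simp only [this]
      exact tendsto_const_nhds
    · have h1 : ContinuousWithinAt (fun s => X s ω) (Set.Ici (τ ω)) (τ ω) :=
        continuousWithinAt_Ioi_iff_Ici.1 ((hXcad ω).1 _ ⟨(hτI ω).1, h⟩)
      exact h1.tendsto.comp (tendsto_nhdsWithin_iff.2
        ⟨hτk_lim ω, Eventually.of_forall fun k => hτk_ge k ω⟩)
  have hτk0 : ∀ k ω, 0 ≤ τk k ω := fun k ω => (hτI ω).1.trans (hτk_ge k ω)
  have hγlim : ∀ ω, Tendsto (fun k => γ (τk k ω) (X (τk k ω) ω)) atTop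
      (𝓝 (γ (τ ω) (X (τ ω) ω))) := by
    intro ω
    have h1 := hγc (τ ω, X (τ ω) ω) ⟨(hτI ω).1, mem_univ _⟩
    have h2 : Tendsto (fun k => (τk k ω, X (τk k ω) ω)) atTop
        (𝓝[Set.Ici 0 ×ˢ Set.univ] (τ ω, X (τ ω) ω)) :=
      tendsto_nhdsWithin_iff.2 ⟨(hτk_lim ω).prodMk_nhds (hXlim ω),
        Eventually.of_forall fun k => ⟨hτk0 k ω, mem_univ _⟩⟩
    exact h1.tendsto.comp h2
  have hIlim : Tendsto (fun k => ∫ ω, γ (τk k ω) (X (τk k ω) ω) ∂P) atTop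
      (𝓝 (∫ ω, γ (τ ω) (X (τ ω) ω) ∂P)) := by
    refine tendsto_integral_of_dominated_convergence (fun _ => C) (fun k => ?_)
      (integrable_const _) (fun k => Eventually.of_forall fun ω => hC _ (hτk0 k ω) _)
      (Eventually.of_forall hγlim)
    refine (measurable_finite_eval (S := insert L (S k)) (f := fun y ω => γ y (X y ω))
      (fun y hy => (hγy y ?_).measurable.comp (hXm y)) (stopping_measurable hXm (hτk_s k))
      (fun ω => firstPt_mem _ _ _)).aestronglyMeasurable
    rcases Finset.mem_insert.1 hy with rfl | h
    · exact hL.1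
    · exact (hSI k y h).1
  refine le_of_tendsto' hIlim fun k => ?_
  refine le_of_forall_pos_sub_le fun ε hε => ?_
  refine le_liminf_of_le ?_ (discrete_le P hT hL hγy hC hXm hXnm hXcad hconv hLg (hSI k)
    (hSg k) (fun y _ => hτs y) hε)
  refine IsBoundedUnder.isCoboundedUnder_ge ⟨C, ?_⟩
  rw [eventually_map]
  exact Eventually.of_forall fun n => optValue_le P hC (Xn n) hL.1
end

section
/- Let X be a càdlàg process with natural filtration ℱ^X and let (Xⁿ) be càdlàg processes with natural filtrations ℱⁿ such that Xⁿ converges to X in probability for the Skorokhod topology. Let τ be an ℱ^X-stopping time bounded by L taking values in a finite set {t_i}_{i∈I} with P[ΔX_{t_i} ≠ 0] = 0 for all i. Set A_i = {τ = t_i} and define τⁿ(ω) = min{t_i : E[1_{A_i} | ℱⁿ_{t_i}](ω) > 1/2} (with the convention that the minimum over the empty set is max_{i∈I} t_i). Then each τⁿ is an ℱⁿ-stopping time bounded by L, and (τⁿ, Xⁿ_{τⁿ}) converges in probability to (τ, X_τ) in ℝ². -/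
open MeasureTheory Filter Set Topology

lemma aux_exists_time {Λ : ℝ → ℝ} {T a v b δ : ℝ} (hc : ContinuousOn Λ (Set.Icc 0 T))
    (h0 : Λ 0 = 0) (hT' : Λ T = T) (ha : 0 ≤ a) (hav : a ≤ v) (hvb : v ≤ b) (hb : b ≤ T)
    (hl : a + δ ≤ v ∨ a = 0) (hr : v + δ ≤ b ∨ b = T)
    (hΛ : ∀ t ∈ Set.Icc (0 : ℝ) T, |Λ t - t| < δ) : ∃ t ∈ Set.Icc a b, Λ t = v := by
  have hab : a ≤ b := hav.trans hvb
  have h1 : Λ a ≤ v := by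
    rcases hl with h | h
    · have := abs_lt.1 (hΛ a ⟨ha, hab.trans hb⟩)
      linarith [this.2]
    · rw [h, h0]; linarith
  have h2 : v ≤ Λ b := by
    rcases hr with h | h
    · have := abs_lt.1 (hΛ b ⟨ha.trans hab, hb⟩)
      linarith [this.1]
    · rw [h, hT']; linarith
  obtain ⟨t, ht, h⟩ := intermediate_value_Icc hab
    (hc.mono (Set.Icc_subset_Icc ha hb)) ⟨h1, h2⟩
  exact ⟨t, ht, h⟩

lemma aux_core {Ω : Type*} [MeasurableSpace Ω] (P : Measure Ω) {T : ℝ}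
    {Xn : ℕ → ℝ → Ω → ℝ} {X : ℝ → Ω → ℝ} (hconv : SkorokhodTendstoP P T Xn X)
    {a v b δ : ℝ} (hδ : 0 < δ) (ha : 0 ≤ a) (hav : a ≤ v) (hvb : v ≤ b) (hb : b ≤ T)
    (hl : a + δ ≤ v ∨ a = 0) (hr : v + δ ≤ b ∨ b = T)
    (Y : Ω → ℝ) {ε : ℝ} (hε : 0 < ε) {η : ENNReal}
    (hη : P {ω | ¬ ∀ t ∈ Set.Icc a b, |X t ω - Y ω| ≤ ε} < η) :
    ∀ᶠ n in atTop, P {ω | 2 * ε ≤ |Xn n v ω - Y ω|} < η := by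
  obtain ⟨Λ, hc, -, h0, hT', -, hX, hL⟩ := hconv
  have hsum := ((hX ε hε).add (hL δ hδ)).add
    (tendsto_const_nhds (x := P {ω | ¬ ∀ t ∈ Set.Icc a b, |X t ω - Y ω| ≤ ε}))
  simp only [zero_add] at hsum
  filter_upwards [hsum.eventually_lt_const hη] with n hn
  refine lt_of_le_of_lt ?_ hn
  refine le_trans (measure_mono ?_) ((measure_union_le _ _).trans
    (add_le_add (measure_union_le _ _) le_rfl))
  intro ω hω
  by_contra hcon
  simp only [Set.mem_union, Set.mem_ofPred_eq, not_or, not_exists, not_and, not_le, not_not]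
    at hcon hω
  obtain ⟨⟨h1, h2⟩, h3⟩ := hcon
  obtain ⟨t, ht, htv⟩ := aux_exists_time (hc n ω) (h0 n ω) (hT' n ω) ha hav hvb hb hl hr h2
  have e1 := h1 t ⟨ha.trans ht.1, ht.2.trans hb⟩
  have e2 := h3 t ht
  rw [htv] at e1
  have := abs_sub_le (Xn n v ω) (X t ω) (Y ω)
  linarith

lemma aux_meas {Ω : Type*} [MeasurableSpace Ω] {T : ℝ} {X : ℝ → Ω → ℝ}
    (hXm : ∀ s : ℝ, Measurable (X s)) (hXcad : ∀ ω, IsCadlagOn T (fun t => X t ω))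
    {a b ε : ℝ} (ha : 0 ≤ a) (hb : b ≤ T) (Y : Ω → ℝ) (hY : Measurable Y) :
    MeasurableSet {ω | ∀ t ∈ Set.Icc a b, |X t ω - Y ω| ≤ ε} := by
  by_cases hab : a ≤ b
  swap
  · have : {ω | ∀ t ∈ Set.Icc a b, |X t ω - Y ω| ≤ ε} = Set.univ := by
      ext ω
      simp only [Set.Icc_eq_empty hab, Set.mem_empty_iff_false, false_imp_iff, implies_true,
        Set.mem_univ, Set.ofPred_true]
    rw [this]; exact MeasurableSet.univ
  have hm : ∀ t, MeasurableSet {ω | |X t ω - Y ω| ≤ ε} := fun t =>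
    measurableSet_le (_root_.continuous_abs.measurable.comp ((hXm t).sub hY)) measurable_const
  have key : {ω | ∀ t ∈ Set.Icc a b, |X t ω - Y ω| ≤ ε} =
      {ω | |X b ω - Y ω| ≤ ε} ∩
        ⋂ q : ℚ, {ω | (q : ℝ) ∈ Set.Icc a b → |X q ω - Y ω| ≤ ε} := by
    ext ω
    simp only [Set.mem_ofPred_eq, Set.mem_inter_iff, Set.mem_iInter]
    constructor
    · intro h
      exact ⟨h b ⟨hab, le_rfl⟩, fun q hq => h q hq⟩
    · rintro ⟨h1, h2⟩ t ht
      rcases ht.2.eq_or_lt with h | h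
      · rw [h]; exact h1
      by_contra hcon
      have hlim := (hXcad ω).1 t ⟨ha.trans ht.1, h.trans_le hb⟩
      have hlim2 : Tendsto (fun s => |X s ω - Y ω|) (nhdsWithin t (Set.Ioi t))
          (nhds |X t ω - Y ω|) := (hlim.sub_const _).abs
      have hev := hlim2.eventually_const_lt (not_le.1 hcon)
      have hev2 := hev.and (Ioo_mem_nhdsGT h)
      obtain ⟨c, hc, hc2⟩ := (mem_nhdsGT_iff_exists_Ioo_subset).1 hev2
      obtain ⟨q, hq1, hq2⟩ := exists_rat_btwn (Set.mem_Ioi.1 hc)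
      have := hc2 ⟨hq1, hq2⟩
      exact absurd (h2 q ⟨ht.1.trans hq1.le, this.2.2.le⟩) (not_le.2 this.1)
  rw [key]
  refine (hm b).inter (MeasurableSet.iInter fun q => ?_)
  by_cases hq : (q : ℝ) ∈ Set.Icc a b
  · simpa [hq] using hm q
  · simp [hq]

lemma aux_small {Ω : Type*} [MeasurableSpace Ω] (P : Measure Ω) [IsProbabilityMeasure P]
    {T : ℝ} {X : ℝ → Ω → ℝ}
    (hXm : ∀ s : ℝ, Measurable (X s)) (hXcad : ∀ ω, IsCadlagOn T (fun t => X t ω))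
    {a b : ℕ → ℝ} {ε : ℝ} (ha : ∀ k, 0 ≤ a k) (hb : ∀ k, b k ≤ T) (Y : Ω → ℝ)
    (hY : Measurable Y)
    (h : ∀ᵐ ω ∂P, ∀ᶠ k in atTop, ∀ t ∈ Set.Icc (a k) (b k), |X t ω - Y ω| ≤ ε) :
    Tendsto (fun k => P {ω | ¬ ∀ t ∈ Set.Icc (a k) (b k), |X t ω - Y ω| ≤ ε}) atTop
      (nhds 0) := by
  have := tendsto_measure_of_ae_tendsto_indicator_of_isFiniteMeasure (μ := P) (A := ∅)
    (As := fun k => {ω | ¬ ∀ t ∈ Set.Icc (a k) (b k), |X t ω - Y ω| ≤ ε}) atTop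
    MeasurableSet.empty
    (fun k => (aux_meas hXm hXcad (ha k) (hb k) Y hY).compl)
    (by
      filter_upwards [h] with ω hω
      filter_upwards [hω] with k hk
      simp only [Set.mem_ofPred_eq, Set.mem_empty_iff_false, iff_false, not_not]
      exact hk)
  simpa using this

/-- pathwise continuity from absence of jump -/
lemma aux_cont {T u : ℝ} {f : ℝ → ℝ} (hu : u ∈ Set.Icc 0 T) (hf : IsCadlagOn T f)
    (hj : pathJump f u = 0) {ε : ℝ} (hε : 0 < ε) :
    ∃ δ > 0, ∀ t ∈ Set.Icc 0 T, |t - u| < δ → |f t - f u| ≤ ε := by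
  have hR : ∃ δ > 0, ∀ t ∈ Set.Icc 0 T, u < t → |t - u| < δ → |f t - f u| ≤ ε := by
    rcases hu.2.eq_or_lt with h | h
    · exact ⟨1, one_pos, fun t ht h1 => absurd ht.2 (by rw [← h]; exact not_le.2 h1)⟩
    · obtain ⟨δ, hδ, h⟩ := Metric.tendsto_nhdsWithin_nhds.1 (hf.1 u ⟨hu.1, h⟩) ε hε
      exact ⟨δ, hδ, fun t _ h1 h2 => (h h1 h2).le⟩
  have hL : ∃ δ > 0, ∀ t ∈ Set.Icc 0 T, t < u → |t - u| < δ → |f t - f u| ≤ ε := by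
    rcases hu.1.eq_or_lt with h | h
    · exact ⟨1, one_pos, fun t ht h1 => absurd ht.1 (by rw [h]; exact not_le.2 h1)⟩
    · obtain ⟨l, hl⟩ := hf.2 u ⟨h, hu.2⟩
      have e : Function.leftLim f u = l := leftLim_eq_of_tendsto hl
      have e2 : f u = l := by
        unfold pathJump at hj; linarith
      rw [← e2] at hl
      obtain ⟨δ, hδ, h⟩ := Metric.tendsto_nhdsWithin_nhds.1 hl ε hε
      exact ⟨δ, hδ, fun t _ h1 h2 => (h h1 h2).le⟩
  obtain ⟨d1, p1, h1⟩ := hR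
  obtain ⟨d2, p2, h2⟩ := hL
  refine ⟨min d1 d2, lt_min p1 p2, fun t ht h => ?_⟩
  rcases lt_trichotomy t u with h' | h' | h'
  · exact h2 t ht h' (h.trans_le (min_le_right _ _))
  · rw [h']; simp [hε.le]
  · exact h1 t ht h' (h.trans_le (min_le_left _ _))

lemma aux_inv_small {c δ : ℝ} (hδ : 0 < δ) :
    ∀ᶠ k : ℕ in atTop, c * (1 / ((k : ℝ) + 1)) < δ := by
  have := (tendsto_one_div_add_atTop_nhds_zero_nat (𝕜 := ℝ)).const_mul c
  rw [mul_zero] at this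
  exact this.eventually_lt_const hδ

/-- convergence at a fixed continuity time -/
lemma aux_point {Ω : Type*} [MeasurableSpace Ω] (P : Measure Ω) [IsProbabilityMeasure P]
    {T : ℝ} {Xn : ℕ → ℝ → Ω → ℝ} {X : ℝ → Ω → ℝ}
    (hXm : ∀ s : ℝ, Measurable (X s)) (hXcad : ∀ ω, IsCadlagOn T (fun t => X t ω))
    (hconv : SkorokhodTendstoP P T Xn X) {u : ℝ} (hu : u ∈ Set.Icc 0 T)
    (hj : P {ω | pathJump (fun r => X r ω) u ≠ 0} = 0) {ε : ℝ} (hε : 0 < ε) {η : ENNReal}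
    (hη : 0 < η) :
    ∀ᶠ n in atTop, P {ω | ε ≤ |Xn n u ω - X u ω|} < η := by
  have hε2 : 0 < ε / 2 := by positivity
  have hs := aux_small P hXm hXcad (ε := ε / 2) (a := fun k : ℕ => max 0 (u - 1 / ((k : ℝ) + 1)))
    (b := fun k : ℕ => min T (u + 1 / ((k : ℝ) + 1))) (fun k => le_max_left _ _)
    (fun k => min_le_left _ _) (X u) (hXm u) (by
      have : ∀ᵐ ω ∂P, pathJump (fun r => X r ω) u = 0 := by
        rw [ae_iff]; exact hj
      filter_upwards [this] with ω hω
      obtain ⟨δ, hδ, h⟩ := aux_cont hu (hXcad ω) hω hε2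
      filter_upwards [aux_inv_small (c := 1) hδ] with k hk t ht
      rw [one_mul] at hk
      have t1 := (le_max_left _ _).trans ht.1
      have t2 := (le_max_right _ _).trans ht.1
      have t3 := ht.2.trans (min_le_left _ _)
      have t4 := ht.2.trans (min_le_right _ _)
      exact h t ⟨t1, t3⟩ (abs_lt.2 ⟨by linarith, by linarith⟩))
  obtain ⟨k, hk⟩ := (hs.eventually_lt_const hη).exists
  have hp : 0 < 1 / ((k : ℝ) + 1) := by positivity
  have := aux_core P hconv (v := u) hp (le_max_left _ _)
    (max_le hu.1 (by linarith)) (le_min hu.2 (by linarith)) (min_le_left _ _)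
    (by
      rcases le_total 0 (u - 1 / ((k : ℝ) + 1)) with h | h
      · left; rw [max_eq_right h]; linarith
      · right; exact max_eq_left h)
    (by
      rcases le_total T (u + 1 / ((k : ℝ) + 1)) with h | h
      · right; exact min_eq_left h
      · left; rw [min_eq_right h])
    (X u) hε2 hk
  simpa only [mul_div_cancel₀ ε (two_ne_zero' ℝ)] using this

/-- approximation from the right -/
lemma aux_right {Ω : Type*} [MeasurableSpace Ω] (P : Measure Ω) [IsProbabilityMeasure P]
    {T : ℝ} {Xn : ℕ → ℝ → Ω → ℝ} {X : ℝ → Ω → ℝ}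
    (hXm : ∀ s : ℝ, Measurable (X s)) (hXcad : ∀ ω, IsCadlagOn T (fun t => X t ω))
    (hconv : SkorokhodTendstoP P T Xn X) {r u : ℝ} (hr : 0 ≤ r) (hru : r < u) (hu : u ≤ T)
    {ε : ℝ} (hε : 0 < ε) {η : ENNReal} (hη : 0 < η) :
    ∃ v ∈ Set.Icc 0 u, ∀ᶠ n in atTop, P {ω | ε ≤ |Xn n v ω - X r ω|} < η := by
  have hε2 : 0 < ε / 2 := by positivity
  have hd : 0 < u - r := sub_pos.2 hru
  have hle : ∀ k : ℕ, (u - r) * (1 / ((k : ℝ) + 1)) ≤ u - r := fun k => by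
    have : 1 / ((k : ℝ) + 1) ≤ 1 := by
      rw [div_le_one (by positivity)]; linarith [(Nat.cast_nonneg k : (0 : ℝ) ≤ k)]
    nlinarith
  have hs := aux_small P hXm hXcad (ε := ε / 2) (a := fun k : ℕ => r)
    (b := fun k : ℕ => r + (u - r) * (1 / ((k : ℝ) + 1))) (fun k => hr)
    (fun k => by linarith [hle k]) (X r) (hXm r) (by
      refine Eventually.of_forall fun ω => ?_
      obtain ⟨δ, hδ, h⟩ := Metric.tendsto_nhdsWithin_nhds.1
        ((hXcad ω).1 r ⟨hr, hru.trans_le hu⟩) (ε / 2) hε2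
      filter_upwards [aux_inv_small (c := u - r) hδ] with k hk t ht
      rcases ht.1.eq_or_lt with h' | h'
      · rw [← h']; simp [hε2.le]
      · refine (h h' ?_).le
        rw [Real.dist_eq, abs_of_pos (sub_pos.2 h')]
        linarith [ht.2])
  obtain ⟨k, hk⟩ := (hs.eventually_lt_const hη).exists
  have hp : 0 < (u - r) * (1 / ((k : ℝ) + 1)) := by positivity
  refine ⟨r + (u - r) * (1 / ((k : ℝ) + 1)) / 2, ⟨by linarith, by linarith [hle k]⟩, ?_⟩
  have := aux_core P hconv (v := r + (u - r) * (1 / ((k : ℝ) + 1)) / 2)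
    (δ := (u - r) * (1 / ((k : ℝ) + 1)) / 2) (by linarith) hr
    (by linarith) (by linarith) (by linarith [hle k])
    (Or.inl le_rfl) (Or.inl (by linarith))
    (X r) hε2 hk
  simpa only [mul_div_cancel₀ ε (two_ne_zero' ℝ)] using this

/-- Sets asymptotically approximable by sets of `F n`. -/
def auxAppr {Ω : Type*} [MeasurableSpace Ω] (P : Measure Ω) (F : ℕ → MeasurableSpace Ω)
    (A : Set Ω) : Prop :=
  ∀ ε : ENNReal, 0 < ε → ∃ B : ℕ → Set Ω, (∀ n, MeasurableSet[F n] (B n)) ∧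
    ∀ᶠ n in atTop, P (symmDiff A (B n)) ≤ ε

lemma auxAppr_union {Ω : Type*} [MeasurableSpace Ω] {P : Measure Ω}
    {F : ℕ → MeasurableSpace Ω} {A A' : Set Ω} (h : auxAppr P F A) (h' : auxAppr P F A') :
    auxAppr P F (A ∪ A') := by
  intro ε hε
  obtain ⟨B, hB, e⟩ := h (ε / 2) (ENNReal.half_pos hε.ne')
  obtain ⟨B', hB', e'⟩ := h' (ε / 2) (ENNReal.half_pos hε.ne')
  refine ⟨fun n => B n ∪ B' n, fun n => MeasurableSet.union (hB n) (hB' n), ?_⟩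
  filter_upwards [e, e'] with n h1 h2
  calc P (symmDiff (A ∪ A') (B n ∪ B' n)) ≤ P (symmDiff A (B n) ∪ symmDiff A' (B' n)) := by
        refine measure_mono ?_
        intro x
        simp only [Set.mem_symmDiff, Set.mem_union]
        tauto
    _ ≤ ε / 2 + ε / 2 := (measure_union_le _ _).trans (add_le_add h1 h2)
    _ = ε := ENNReal.add_halves ε

lemma auxAppr_empty {Ω : Type*} [MeasurableSpace Ω] {P : Measure Ω}
    {F : ℕ → MeasurableSpace Ω} : auxAppr P F ∅ := by
  intro ε hε
  refine ⟨fun _ => ∅, fun n => @MeasurableSet.empty _ (F n), ?_⟩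
  simp

lemma auxAppr_accumulate {Ω : Type*} [MeasurableSpace Ω] {P : Measure Ω}
    {F : ℕ → MeasurableSpace Ω} {A : ℕ → Set Ω} (h : ∀ i, auxAppr P F (A i)) (k : ℕ) :
    auxAppr P F (Set.accumulate A k) := by
  induction k with
  | zero => simpa [Set.accumulate_zero_nat] using h 0
  | succ k ih => rw [Set.accumulate_succ]; exact auxAppr_union ih (h _)

/-- The σ-algebra of asymptotically approximable sets. -/
def auxSigma {Ω : Type*} [MeasurableSpace Ω] (P : Measure Ω) [IsProbabilityMeasure P]
    (F : ℕ → MeasurableSpace Ω) : MeasurableSpace Ω where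
  MeasurableSet' A := MeasurableSet A ∧ auxAppr P F A
  measurableSet_empty := ⟨MeasurableSet.empty, auxAppr_empty⟩
  measurableSet_compl A hA := by
    refine ⟨hA.1.compl, fun ε hε => ?_⟩
    obtain ⟨B, hB, e⟩ := hA.2 ε hε
    refine ⟨fun n => (B n)ᶜ, fun n => MeasurableSet.compl (hB n), ?_⟩
    simpa using e
  measurableSet_iUnion A hA := by
    have hm : MeasurableSet (⋃ i, A i) := MeasurableSet.iUnion fun i => (hA i).1
    refine ⟨hm, fun ε hε => ?_⟩
    have hacc : ∀ k, MeasurableSet (Set.accumulate A k) := fun k => by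
      rw [Set.accumulate_def]
      exact MeasurableSet.biUnion (Set.to_countable _) fun i _ => (hA i).1
    have ht : Tendsto (fun k => P ((⋃ i, A i) \ Set.accumulate A k)) atTop (nhds 0) := by
      have := tendsto_measure_of_ae_tendsto_indicator_of_isFiniteMeasure (μ := P) (A := ∅)
        (As := fun k => (⋃ i, A i) \ Set.accumulate A k) atTop
        MeasurableSet.empty (fun k => hm.diff (hacc k))
        (by
          refine Eventually.of_forall fun ω => ?_
          by_cases hω : ω ∈ ⋃ i, A i
          · obtain ⟨i, hi⟩ := Set.mem_iUnion.1 hω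
            filter_upwards [eventually_ge_atTop i] with k hk
            simp only [Set.mem_sdiff, Set.mem_empty_iff_false, iff_false, not_and, not_not]
            intro _
            exact Set.mem_accumulate.2 ⟨i, hk, hi⟩
          · exact Eventually.of_forall fun k => by simp only [Set.mem_sdiff, hω, false_and,
              Set.mem_empty_iff_false])
      simpa using this
    obtain ⟨k, hk⟩ := (ht.eventually_lt_const (ENNReal.half_pos hε.ne')).exists
    obtain ⟨B, hB, e⟩ := auxAppr_accumulate (fun i => (hA i).2) k (ε / 2)
      (ENNReal.half_pos hε.ne')
    refine ⟨B, hB, ?_⟩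
    filter_upwards [e] with n hn
    have hsub : Set.accumulate A k ⊆ ⋃ i, A i := by
      intro x hx
      obtain ⟨i, _, hi⟩ := Set.mem_accumulate.1 hx
      exact Set.mem_iUnion.2 ⟨i, hi⟩
    calc P (symmDiff (⋃ i, A i) (B n))
        ≤ P (((⋃ i, A i) \ Set.accumulate A k) ∪ symmDiff (Set.accumulate A k) (B n)) := by
          refine measure_mono ?_
          intro x hx
          have := @hsub x
          simp only [Set.mem_symmDiff, Set.mem_union, Set.mem_sdiff] at hx ⊢
          tauto
      _ ≤ ε / 2 + ε / 2 := (measure_union_le _ _).trans (add_le_add hk.le hn)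
      _ = ε := ENNReal.add_halves ε

lemma aux_generator {Ω : Type*} [MeasurableSpace Ω] (P : Measure Ω) [IsProbabilityMeasure P]
    (F : ℕ → MeasurableSpace Ω) (Y : Ω → ℝ) (hY : Measurable Y)
    (h : ∀ ε : ℝ, 0 < ε → ∀ η : ENNReal, 0 < η → ∃ g : ℕ → Ω → ℝ,
      (∀ n, Measurable[F n] (g n)) ∧ ∀ᶠ n in atTop, P {ω | ε ≤ |g n ω - Y ω|} < η) (c : ℝ) :
    auxAppr P F {ω | Y ω < c} := by
  intro ε hε
  have ht : Tendsto (fun k : ℕ => P {ω | c - 2 * (1 / ((k : ℝ) + 1)) ≤ Y ω ∧ Y ω < c}) atTop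
      (nhds 0) := by
    have := tendsto_measure_of_ae_tendsto_indicator_of_isFiniteMeasure (μ := P) (A := ∅)
        (As := fun k : ℕ => {ω | c - 2 * (1 / ((k : ℝ) + 1)) ≤ Y ω ∧ Y ω < c}) atTop
        MeasurableSet.empty (fun k => (measurableSet_le measurable_const hY).inter
          (measurableSet_lt hY measurable_const))
        (by
          refine Eventually.of_forall fun ω => ?_
          by_cases hω : Y ω < c
          · filter_upwards [aux_inv_small (c := 2) (sub_pos.2 hω)] with k hk
            simp only [Set.mem_ofPred_eq, Set.mem_empty_iff_false, iff_false, not_and, not_lt]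
            intro h3
            linarith
          · exact Eventually.of_forall fun k => by simp [hω])
    simpa using this
  obtain ⟨k, hk⟩ := (ht.eventually_lt_const (ENNReal.half_pos hε.ne')).exists
  have hp : 0 < 1 / ((k : ℝ) + 1) := by positivity
  generalize 1 / ((k : ℝ) + 1) = δ at hk hp
  obtain ⟨g, hg, e⟩ := h δ hp (ε / 2) (ENNReal.half_pos hε.ne')
  refine ⟨fun n => {ω | g n ω < c - δ}, fun n => (hg n) measurableSet_Iio, ?_⟩
  filter_upwards [e] with n hn
  calc P (symmDiff {ω | Y ω < c} {ω | g n ω < c - δ})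
      ≤ P ({ω | c - 2 * δ ≤ Y ω ∧ Y ω < c} ∪ {ω | δ ≤ |g n ω - Y ω|}) := by
        refine measure_mono ?_
        intro x hx
        simp only [Set.mem_symmDiff, Set.mem_union, Set.mem_ofPred_eq, not_lt] at hx ⊢
        by_contra hcon
        simp only [not_or, not_and, not_lt, not_le, abs_lt] at hcon
        obtain ⟨h1, h2, h3⟩ := hcon
        rcases hx with ⟨h4, h5⟩ | ⟨h4, h5⟩
        · by_cases h6 : c - 2 * δ ≤ Y x
          · linarith [h1 h6]
          · linarith
        · linarith
    _ ≤ ε / 2 + ε / 2 := (measure_union_le _ _).trans (add_le_add hk.le hn.le)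
    _ = ε := ENNReal.add_halves ε

lemma aux_natFilt_le {Ω : Type*} [m : MeasurableSpace Ω] {X : ℝ → Ω → ℝ}
    (hXm : ∀ s : ℝ, Measurable (X s)) (t : ℝ) : natFilt X t ≤ m := by
  refine iSup₂_le fun s _ => ?_
  have := (hXm s).comap_le
  rwa [BorelSpace.measurable_eq (α := ℝ)] at this

lemma aux_natFilt_mono {Ω : Type*} (X : ℝ → Ω → ℝ) {t t' : ℝ} (h : t ≤ t') :
    natFilt X t ≤ natFilt X t' := by
  refine iSup₂_le fun s hs => ?_
  exact le_iSup₂ (f := fun s (_ : s ∈ Set.Icc (0 : ℝ) t') => MeasurableSpace.comap (X s) (borel ℝ))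
    s ⟨hs.1, hs.2.trans h⟩

lemma aux_natFilt_meas {Ω : Type*} (X : ℝ → Ω → ℝ) {s t : ℝ} (h : s ∈ Set.Icc 0 t) :
    Measurable[natFilt X t] (X s) := by
  rw [measurable_iff_comap_le, BorelSpace.measurable_eq (α := ℝ)]
  exact le_iSup₂ (f := fun s (_ : s ∈ Set.Icc (0 : ℝ) t) => MeasurableSpace.comap (X s) (borel ℝ))
    s h

lemma aux_natFilt_sigma {Ω : Type*} [MeasurableSpace Ω] (P : Measure Ω) [IsProbabilityMeasure P]
    {T : ℝ} {Xn : ℕ → ℝ → Ω → ℝ} {X : ℝ → Ω → ℝ}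
    (hXm : ∀ s : ℝ, Measurable (X s)) (hXcad : ∀ ω, IsCadlagOn T (fun t => X t ω))
    (hconv : SkorokhodTendstoP P T Xn X) {u : ℝ} (hu : u ∈ Set.Icc 0 T)
    (hj : P {ω | pathJump (fun r => X r ω) u ≠ 0} = 0) :
    natFilt X u ≤ auxSigma P (fun n => natFilt (Xn n) u) := by
  refine iSup₂_le fun r hr => ?_
  have key : ∀ c : ℝ, MeasurableSet {ω | X r ω < c} ∧
      auxAppr P (fun n => natFilt (Xn n) u) {ω | X r ω < c} := by
    intro c
    refine ⟨(hXm r) measurableSet_Iio, ?_⟩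
    refine aux_generator P _ (X r) (hXm r) ?_ c
    intro ε hε η hη
    rcases hr.2.eq_or_lt with h | h
    · rw [h]
      exact ⟨fun n => Xn n u, fun n => aux_natFilt_meas _ ⟨hu.1, le_rfl⟩,
        aux_point P hXm hXcad hconv hu hj hε hη⟩
    · obtain ⟨v, hv, e⟩ := aux_right P hXm hXcad hconv hr.1 h hu.2 hε hη
      exact ⟨fun n => Xn n v, fun n => aux_natFilt_meas _ hv, e⟩
  rw [← BorelSpace.measurable_eq (α := ℝ), ← measurable_iff_comap_le]
  let M : MeasurableSpace Ω := auxSigma P (fun n => natFilt (Xn n) u)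
  have key' : ∀ c : ℝ, MeasurableSet[M] (X r ⁻¹' Set.Iio c) := key
  exact measurable_of_Iio key'

lemma aux_cev_bound {Ω : Type*} {m : MeasurableSpace Ω} [m0 : MeasurableSpace Ω]
    (P : Measure Ω) [IsProbabilityMeasure P] (hm : m ≤ m0) {A B : Set Ω} (hA : MeasurableSet A)
    (hB : MeasurableSet[m] B) :
    P {ω | 1 / 2 ≤ |cev P m A ω - A.indicator (fun _ => (1 : ℝ)) ω|} ≤
      4 * P (symmDiff A B) := by
  have hB0 : MeasurableSet B := hm _ hB
  set f : Ω → ℝ := A.indicator (fun _ => (1 : ℝ)) with hf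
  set g : Ω → ℝ := B.indicator (fun _ => (1 : ℝ)) with hg
  have hfi : Integrable f P := (integrable_const 1).indicator hA
  have hgi : Integrable g P := (integrable_const 1).indicator hB0
  have hgm : P[g | m] = g := condExp_of_stronglyMeasurable hm
    (stronglyMeasurable_const.indicator hB) hgi
  have hnorm : eLpNorm (f - g) 1 P = P (symmDiff A B) := by
    have : eLpNorm (f - g) 1 P = eLpNorm ((symmDiff A B).indicator (fun _ => (1 : ℝ))) 1 P := by
      refine eLpNorm_congr_norm_ae (Eventually.of_forall fun ω => ?_)
      by_cases h1 : ω ∈ A <;> by_cases h2 : ω ∈ B <;>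
        simp [hf, hg, h1, h2, Set.mem_symmDiff]
    rw [this, eLpNorm_indicator_const (hA.symmDiff hB0) one_ne_zero ENNReal.one_ne_top]
    simp
  have hce : P[f - g | m] =ᵐ[P] P[f | m] - g := by
    have := condExp_sub hfi hgi m
    rwa [hgm] at this
  have hdecomp : cev P m A - f =ᵐ[P] P[f - g | m] - (f - g) := by
    filter_upwards [hce] with ω hω
    simp only [Pi.sub_apply, hω, cev]
    ring
  have hL1 : eLpNorm (cev P m A - f) 1 P ≤ 2 * P (symmDiff A B) := by
    rw [eLpNorm_congr_ae hdecomp]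
    refine (eLpNorm_sub_le integrable_condExp.aestronglyMeasurable
      (hfi.sub hgi).aestronglyMeasurable le_rfl).trans ?_
    rw [two_mul]
    refine add_le_add ((eLpNorm_one_condExp_le_eLpNorm _).trans hnorm.le) hnorm.le
  have hae : AEStronglyMeasurable (cev P m A - f) P :=
    (integrable_condExp.sub hfi).aestronglyMeasurable
  have hmk := meas_ge_le_mul_pow_eLpNorm_enorm P one_ne_zero ENNReal.one_ne_top hae
    (ε := 1 / 2) (by simp) (by simp)
  have hset : {ω | 1 / 2 ≤ |cev P m A ω - f ω|} ⊆ {x | (1 / 2 : ENNReal) ≤ ‖(cev P m A - f) x‖ₑ} := by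
    intro ω hω
    simp only [Set.mem_ofPred_eq, Pi.sub_apply] at hω ⊢
    rw [Real.enorm_eq_ofReal_abs]
    have : (1 / 2 : ENNReal) = ENNReal.ofReal (1 / 2) := by
      rw [ENNReal.ofReal_div_of_pos (by norm_num)]; simp
    rw [this]
    exact ENNReal.ofReal_le_ofReal hω
  refine (measure_mono hset).trans (hmk.trans ?_)
  simp only [ENNReal.toReal_one, ENNReal.rpow_one, one_div, inv_inv]
  calc 2 * eLpNorm (cev P m A - f) 1 P ≤ 2 * (2 * P (symmDiff A B)) := by gcongr
    _ = 4 * P (symmDiff A B) := by rw [← mul_assoc]; norm_num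

/-- (Lemma `T^n`.) Given a stopping time `τ` taking finitely many
values `u ∈ s` which are continuity points of `X`, the stopping times
`τⁿ = min {u ∈ s : E[1_{τ = u} | ℱⁿ_u] > 1/2}` (with value `max s` when this set is
empty) are `ℱⁿ`-stopping times bounded by `L` and `(τⁿ, Xⁿ_{τⁿ}) →P (τ, X_τ)`. -/
theorem discrete_stopping_time_approximation
    {Ω : Type*} [MeasurableSpace Ω] (P : Measure Ω) [IsProbabilityMeasure P]
    (T L : ℝ) (hT : 0 < T) (hL : L ∈ Set.Icc 0 T)
    (X : ℝ → Ω → ℝ) (Xn : ℕ → ℝ → Ω → ℝ)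
    (hXm : ∀ s : ℝ, Measurable (X s)) (hXnm : ∀ n, ∀ s : ℝ, Measurable (Xn n s))
    (hXcad : ∀ ω, IsCadlagOn T (fun t => X t ω))
    (hXncad : ∀ n ω, IsCadlagOn T (fun t => Xn n t ω))
    (hconv : SkorokhodTendstoP P T Xn X)
    (s : Finset ℝ) (hs : s.Nonempty) (hsL : ∀ u ∈ s, u ∈ Set.Icc (0 : ℝ) L)
    (hscont : ∀ u ∈ s, P {ω | pathJump (fun r => X r ω) u ≠ 0} = 0)
    (τ : Ω → ℝ) (hτ : IsStoppingTimeOn (natFilt X) τ) (hτs : ∀ ω, τ ω ∈ s)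
    (τn : ℕ → Ω → ℝ)
    (hτdef : ∀ n ω, (∃ u ∈ s, 1/2 < cev P (natFilt (Xn n) u) {ω' | τ ω' = u} ω) →
      τn n ω ∈ s ∧ 1/2 < cev P (natFilt (Xn n) (τn n ω)) {ω' | τ ω' = τn n ω} ω ∧
      ∀ u ∈ s, 1/2 < cev P (natFilt (Xn n) u) {ω' | τ ω' = u} ω → τn n ω ≤ u)
    (hτdef' : ∀ n ω, (¬ ∃ u ∈ s, 1/2 < cev P (natFilt (Xn n) u) {ω' | τ ω' = u} ω) →
      τn n ω = s.max' hs) :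
    (∀ n, IsStoppingTimeOn (natFilt (Xn n)) (τn n)) ∧
    (∀ n ω, τn n ω ∈ Set.Icc 0 L) ∧
    (∀ ε : ℝ, 0 < ε → Filter.Tendsto
      (fun n => P {ω | ε ≤ max |τn n ω - τ ω| |Xn n (τn n ω) ω - X (τ ω) ω|})
      Filter.atTop (nhds 0)) := by
  have hsT : ∀ u ∈ s, u ∈ Set.Icc (0 : ℝ) T := fun u hu =>
    ⟨(hsL u hu).1, (hsL u hu).2.trans hL.2⟩
  have hmem : ∀ n ω, τn n ω ∈ s := by
    intro n ω
    by_cases h : ∃ u ∈ s, 1/2 < cev P (natFilt (Xn n) u) {ω' | τ ω' = u} ω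
    · exact (hτdef n ω h).1
    · rw [hτdef' n ω h]; exact s.max'_mem hs
  refine ⟨fun n t => ?_, fun n ω => hsL _ (hmem n ω), fun ε hε => ?_⟩
  · by_cases ht : s.max' hs ≤ t
    · have : {ω | τn n ω ≤ t} = Set.univ := by
        ext ω
        simp only [Set.mem_ofPred_eq, Set.mem_univ, iff_true]
        exact (s.le_max' _ (hmem n ω)).trans ht
      rw [this]; exact MeasurableSet.univ
    · have : {ω | τn n ω ≤ t} = ⋃ u ∈ s.filter (fun u => u ≤ t),
          {ω | 1/2 < cev P (natFilt (Xn n) u) {ω' | τ ω' = u} ω} := by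
        ext ω
        simp only [Set.mem_ofPred_eq, Set.mem_iUnion, Finset.mem_filter, exists_prop]
        constructor
        · intro h
          by_cases hex : ∃ u ∈ s, 1/2 < cev P (natFilt (Xn n) u) {ω' | τ ω' = u} ω
          · have := hτdef n ω hex
            exact ⟨τn n ω, ⟨this.1, h⟩, this.2.1⟩
          · rw [hτdef' n ω hex] at h
            exact absurd h ht
        · rintro ⟨u, ⟨hu, hut⟩, h⟩
          exact ((hτdef n ω ⟨u, hu, h⟩).2.2 u hu h).trans hut
      rw [this]
      refine Finset.measurableSet_biUnion _ fun u hu => ?_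
      refine aux_natFilt_mono (Xn n) (Finset.mem_filter.1 hu).2 _ ?_
      exact (stronglyMeasurable_condExp (m := natFilt (Xn n) u)).measurable measurableSet_Ioi
  · -- the events `τ = u`
    have hA : ∀ u ∈ s, MeasurableSet[natFilt X u] {ω' | τ ω' = u} := by
      intro u hu
      have : {ω' | τ ω' = u} = {ω | τ ω ≤ u} \ ⋃ w ∈ s.filter (fun w => w < u), {ω | τ ω ≤ w} := by
        ext ω
        simp only [Set.mem_ofPred_eq, Set.mem_sdiff, Set.mem_iUnion, Finset.mem_filter, exists_prop,
          not_exists, not_and, not_le]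
        constructor
        · rintro rfl
          exact ⟨le_rfl, fun w hw => hw.2⟩
        · rintro ⟨h1, h2⟩
          by_contra hne
          exact lt_irrefl _ (h2 (τ ω) ⟨hτs ω, lt_of_le_of_ne h1 hne⟩)
      rw [this]
      refine MeasurableSet.diff (hτ u) (Finset.measurableSet_biUnion _ fun w hw => ?_)
      exact aux_natFilt_mono X (Finset.mem_filter.1 hw).2.le _ (hτ w)
    have hc1 : ∀ u ∈ s, Tendsto (fun n => P {ω | 1 / 2 ≤
        |cev P (natFilt (Xn n) u) {ω' | τ ω' = u} ω -
          Set.indicator {ω' | τ ω' = u} (fun _ => (1 : ℝ)) ω|}) atTop (nhds 0) := by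
      intro u hu
      have hS := aux_natFilt_sigma P hXm hXcad hconv (hsT u hu) (hscont u hu) _ (hA u hu)
      rw [ENNReal.tendsto_nhds_zero]
      intro η hη
      obtain ⟨B, hB, e⟩ := hS.2 (η / 4) (ENNReal.div_pos hη.ne' (by norm_num))
      filter_upwards [e] with n hn
      refine (aux_cev_bound P (aux_natFilt_le (hXnm n) u) hS.1 (hB n)).trans ?_
      calc 4 * P (symmDiff {ω' | τ ω' = u} (B n)) ≤ 4 * (η / 4) := by gcongr
        _ = η := ENNReal.mul_div_cancel (by norm_num) (by norm_num)
    have hc2 : ∀ u ∈ s, Tendsto (fun n => P {ω | ε ≤ |Xn n u ω - X u ω|}) atTop (nhds 0) := by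
      intro u hu
      rw [ENNReal.tendsto_nhds_zero]
      intro η hη
      filter_upwards [aux_point P hXm hXcad hconv (hsT u hu) (hscont u hu) hε hη] with n hn
      exact hn.le
    have hsum := tendsto_finsetSum s fun u hu => (hc1 u hu).add (hc2 u hu)
    simp only [add_zero, Finset.sum_const_zero] at hsum
    refine tendsto_of_tendsto_of_tendsto_of_le_of_le tendsto_const_nhds hsum
      (fun _ => zero_le) fun n => ?_
    refine le_trans ?_ (Finset.sum_le_sum fun u _ => measure_union_le _ _)
    refine le_trans (measure_mono ?_) (measure_biUnion_finset_le _ _)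
    intro ω hω
    by_contra hcon
    simp only [Set.mem_iUnion, Set.mem_union, Set.mem_ofPred_eq, exists_prop, not_exists, not_and,
      not_or, not_le] at hcon hω
    have hself : 1/2 < cev P (natFilt (Xn n) (τ ω)) {ω' | τ ω' = τ ω} ω := by
      have := (hcon (τ ω) (hτs ω)).1
      rw [Set.indicator_of_mem (show ω ∈ {ω' | τ ω' = τ ω} from rfl)] at this
      linarith [(abs_lt.1 this).1]
    have hd := hτdef n ω ⟨τ ω, hτs ω, hself⟩
    have heq : τ ω = τn n ω := by
      by_contra hne
      have := (hcon (τn n ω) hd.1).1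
      rw [Set.indicator_of_notMem (show ω ∉ {ω' | τ ω' = τn n ω} from hne)] at this
      linarith [(abs_lt.1 this).2, hd.2.1]
    rw [← heq, sub_self, abs_zero] at hω
    have h2 := (hcon (τ ω) (hτs ω)).2
    exact absurd hω (not_le.2 (max_lt hε h2))
end

section
/- Let X be a càdlàg process with P[ΔX_L ≠ 0] = 0 and natural filtration ℱ^X, and let (Xⁿ) be càdlàg processes with natural filtrations ℱⁿ such that Xⁿ converges to X in probability for the Skorokhod topology. Let π = {t₁ < … < t_m} be a finite subdivision of [0,T] such that P[ΔX_{t_i} ≠ 0] = 0 for every i. Then Γ^π(L) ≤ liminf_{n→∞} Γₙ(L), where Γ^π(L) = sup{E[γ(τ, X_τ)] : τ an ℱ^X-stopping time with τ ≤ L taking values in π} and Γₙ(L) = sup{E[γ(τ, Xⁿ_τ)] : τ an ℱⁿ-stopping time with τ ≤ L}. -/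
open MeasureTheory Filter Set Topology

namespace SubdivAux

lemma cad_rat {T : ℝ} {f : ℝ → ℝ}
    (hf : ∀ t ∈ Set.Ico (0 : ℝ) T, Tendsto f (𝓝[>] t) (𝓝 (f t)))
    {a b c : ℝ} (ha : 0 ≤ a) (hb : b ≤ T) :
    (∃ r ∈ Ioo a b, c < f r) ↔ ∃ q : ℚ, (q : ℝ) ∈ Ioo a b ∧ c < f q := by
  constructor
  · rintro ⟨r, hr, hc⟩
    have h1 := (hf r ⟨ha.trans hr.1.le, hr.2.trans_le hb⟩).eventually (lt_mem_nhds hc)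
    obtain ⟨d, hd, hd'⟩ := (mem_nhdsGT_iff_exists_Ioo_subset' hr.2).1 h1
    obtain ⟨q, hq1, hq2⟩ := exists_rat_btwn (lt_min hd hr.2)
    exact ⟨q, ⟨hr.1.trans hq1, hq2.trans_le (min_le_right _ _)⟩,
      hd' ⟨hq1, hq2.trans_le (min_le_left _ _)⟩⟩
  · rintro ⟨q, hq, hc⟩
    exact ⟨q, hq, hc⟩

lemma meas_natFilt {Ω : Type*} (X : ℝ → Ω → ℝ) {s t : ℝ} (hs : s ∈ Icc 0 t) :
    Measurable[natFilt X t] (X s) := by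
  have : MeasurableSpace.comap (X s) (borel ℝ) ≤ natFilt X t :=
    le_iSup₂_of_le (f := fun s (_ : s ∈ Icc (0:ℝ) t) => MeasurableSpace.comap (X s) (borel ℝ))
      s hs le_rfl
  exact measurable_iff_comap_le.2 this

lemma natFilt_mono {Ω : Type*} (X : ℝ → Ω → ℝ) {s t : ℝ} (h : s ≤ t) :
    natFilt X s ≤ natFilt X t := by
  refine iSup₂_le fun u hu => ?_
  exact measurable_iff_comap_le.1 (meas_natFilt X ⟨hu.1, hu.2.trans h⟩)

lemma natFilt_le {Ω : Type*} [m : MeasurableSpace Ω] {X : ℝ → Ω → ℝ}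
    (hX : ∀ s, Measurable (X s)) (t : ℝ) : natFilt X t ≤ m := by
  refine iSup₂_le fun u hu => ?_
  exact measurable_iff_comap_le.1 (hX u)

lemma meas_E {Ω : Type*} {T : ℝ} {X : ℝ → Ω → ℝ} (hX : ∀ ω, IsCadlagOn T (fun t => X t ω))
    {a b c t : ℝ} (ha : 0 ≤ a) (hb : b ≤ T) (hbt : b ≤ t) :
    MeasurableSet[natFilt X t] {ω | ∃ r ∈ Ioo a b, c < X r ω} := by
  have : {ω | ∃ r ∈ Ioo a b, c < X r ω} =
      ⋃ q : ℚ, ⋃ (_ : (q : ℝ) ∈ Ioo a b), (X q) ⁻¹' (Ioi c) := by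
    ext ω
    simp only [mem_ofPred_eq, mem_iUnion, mem_preimage, mem_Ioi]
    rw [cad_rat (hX ω).1 ha hb]
    simp
  rw [this]
  refine MeasurableSet.iUnion fun q => MeasurableSet.iUnion fun hq => ?_
  exact meas_natFilt X ⟨ha.trans hq.1.le, hq.2.le.trans hbt⟩ measurableSet_Ioi

/-- The sets which are asymptotically approximated by elements of `F n`. -/
def approxSA {Ω : Type*} [MeasurableSpace Ω] (P : Measure Ω) [IsProbabilityMeasure P]
    (F : ℕ → MeasurableSpace Ω) : MeasurableSpace Ω where
  MeasurableSet' A := MeasurableSet A ∧ ∀ ε : ENNReal, 0 < ε → ∀ᶠ n in atTop,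
    ∃ B, MeasurableSet[F n] B ∧ P (symmDiff A B) ≤ ε
  measurableSet_empty := ⟨MeasurableSet.empty, fun ε hε => Eventually.of_forall fun n =>
    ⟨∅, @MeasurableSet.empty _ (F n), by simp⟩⟩
  measurableSet_compl A hA := by
    refine ⟨hA.1.compl, fun ε hε => ?_⟩
    filter_upwards [hA.2 ε hε] with n ⟨B, hB, h⟩
    refine ⟨Bᶜ, hB.compl, ?_⟩
    rwa [compl_symmDiff_compl]
  measurableSet_iUnion A hA := by
    refine ⟨MeasurableSet.iUnion fun i => (hA i).1, ?_⟩
    have key : ∀ N : ℕ, ∀ ε : ENNReal, 0 < ε → ∀ᶠ n in atTop,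
        ∃ B, MeasurableSet[F n] B ∧ P (symmDiff (⋃ i, ⋃ (_ : i < N), A i) B) ≤ ε := by
      intro N
      induction N with
      | zero =>
        intro ε hε
        exact Eventually.of_forall fun n => ⟨∅, @MeasurableSet.empty _ (F n), by simp⟩
      | succ N ih =>
        intro ε hε
        filter_upwards [ih (ε/2) (ENNReal.half_pos hε.ne'),
          (hA N).2 (ε/2) (ENNReal.half_pos hε.ne')] with n ⟨B, hB, h⟩ ⟨B', hB', h'⟩
        refine ⟨B ∪ B', hB.union hB', ?_⟩
        calc _ ≤ P (symmDiff (⋃ i, ⋃ (_ : i < N), A i) B ∪ symmDiff (A N) B') := by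
              apply measure_mono
              rw [biUnion_lt_succ]
              intro x hx
              simp only [mem_symmDiff, mem_union] at hx ⊢
              tauto
          _ ≤ _ := measure_union_le _ _
          _ ≤ ε/2 + ε/2 := add_le_add h h'
          _ = ε := ENNReal.add_halves ε
    intro ε hε
    have hanti : Antitone (fun N : ℕ => (⋃ i, A i) \ (⋃ i, ⋃ (_ : i < N), A i)) := by
      intro N M hNM x hx
      simp only [Set.mem_sdiff, mem_iUnion, not_exists] at hx ⊢
      exact ⟨hx.1, fun i hi => hx.2 i (hi.trans_le hNM)⟩
    have hemp : (⋂ N : ℕ, (⋃ i, A i) \ (⋃ i, ⋃ (_ : i < N), A i)) = ∅ := by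
      ext x
      simp only [mem_iInter, Set.mem_sdiff, mem_iUnion, not_exists, mem_empty_iff_false, iff_false]
      intro h
      obtain ⟨i, hi⟩ := (h 0).1
      exact (h (i+1)).2 i (Nat.lt_succ_self i) hi
    have hlim := tendsto_measure_iInter_atTop (μ := P)
      (s := fun N : ℕ => (⋃ i, A i) \ (⋃ i, ⋃ (_ : i < N), A i))
      (fun N => ((MeasurableSet.iUnion fun i => (hA i).1).diff
        (MeasurableSet.iUnion fun i => MeasurableSet.iUnion fun _ => (hA i).1)).nullMeasurableSet)
      hanti ⟨0, measure_ne_top _ _⟩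
    rw [hemp, measure_empty] at hlim
    obtain ⟨N, hN⟩ := (ENNReal.tendsto_nhds_zero.1 hlim (ε/2) (ENNReal.half_pos hε.ne')).exists
    filter_upwards [key N (ε/2) (ENNReal.half_pos hε.ne')] with n ⟨B, hB, h⟩
    refine ⟨B, hB, ?_⟩
    calc _ ≤ P (((⋃ i, A i) \ (⋃ i, ⋃ (_ : i < N), A i)) ∪
          symmDiff (⋃ i, ⋃ (_ : i < N), A i) B) := by
          apply measure_mono
          have hsub : (⋃ i, ⋃ (_ : i < N), A i) ⊆ ⋃ i, A i :=
            iUnion_mono fun i => iUnion_subset fun _ => subset_rfl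
          intro x hx
          have := @hsub x
          simp only [mem_symmDiff, mem_union, Set.mem_sdiff] at hx ⊢
          tauto
      _ ≤ _ := measure_union_le _ _
      _ ≤ ε/2 + ε/2 := add_le_add hN h
      _ = ε := ENNReal.add_halves ε

lemma three {Ω : Type*} [MeasurableSpace Ω] (P : Measure Ω) {S A B C : Set Ω} {ε : ENNReal}
    (h : S ⊆ A ∪ B ∪ C) (hA : P A ≤ ε/3) (hB : P B ≤ ε/3) (hC : P C ≤ ε/3) : P S ≤ ε := by
  calc P S ≤ P (A ∪ B ∪ C) := measure_mono h
    _ ≤ P A + P B + P C := (measure_union_le _ _).trans (by gcongr; exact measure_union_le _ _)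
    _ ≤ ε/3 + ε/3 + ε/3 := by gcongr
    _ = ε := ENNReal.add_thirds ε

lemma third_pos {ε : ENNReal} (h : 0 < ε) : 0 < ε/3 :=
  ENNReal.div_pos h.ne' (by simp)

section main
variable {Ω : Type*} [MeasurableSpace Ω] {P : Measure Ω} [IsProbabilityMeasure P]
    {T : ℝ} {X : ℝ → Ω → ℝ} {Xn : ℕ → ℝ → Ω → ℝ}

lemma exists_preimage {T : ℝ} (hT : 0 < T) {f : ℝ → ℝ} (hc : ContinuousOn f (Icc 0 T))
    (h0 : f 0 = 0) (h1 : f T = T) {t : ℝ} (ht : t ∈ Icc 0 T) : ∃ r ∈ Icc 0 T, f r = t := by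
  have := intermediate_value_Icc hT.le hc
  rw [h0, h1] at this
  exact this ht

lemma contAt (hX : ∀ ω, IsCadlagOn T (fun t => X t ω)) {t : ℝ} (ht : t ∈ Ioo 0 T) {ω : Ω}
    (hj : pathJump (fun r => X r ω) t = 0) : ContinuousAt (fun r => X r ω) t := by
  rw [continuousAt_iff_continuous_left'_right']
  refine ⟨?_, (hX ω).1 t ⟨ht.1.le, ht.2⟩⟩
  obtain ⟨l, hl⟩ := (hX ω).2 t ⟨ht.1, ht.2.le⟩
  have : Function.leftLim (fun r => X r ω) t = l :=
    leftLim_eq_of_tendsto hl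
  unfold pathJump at hj
  have h2 : X t ω = l := by rw [this] at hj; simpa using sub_eq_zero.1 hj
  unfold ContinuousWithinAt
  simpa [h2] using hl

lemma conv_at (hT : 0 < T) (hXm : ∀ s : ℝ, Measurable (X s))
    (hX : ∀ ω, IsCadlagOn T (fun t => X t ω)) (hconv : SkorokhodTendstoP P T Xn X)
    {t : ℝ} (ht : t ∈ Icc 0 T) (hj : P {ω | pathJump (fun r => X r ω) t ≠ 0} = 0)
    {ε : ℝ} (hε : 0 < ε) :
    Tendsto (fun n => P {ω | ε ≤ |Xn n t ω - X t ω|}) atTop (𝓝 0) := by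
  obtain ⟨Λ, hΛc, hΛm, h0, h1, hmap, hc1, hc2⟩ := hconv
  rcases eq_or_lt_of_le ht.1 with h | ht0
  · subst h
    refine tendsto_of_tendsto_of_tendsto_of_le_of_le tendsto_const_nhds (hc1 ε hε)
      (fun _ => zero_le) (fun n => measure_mono fun ω hω => ⟨0, ht, ?_⟩)
    rw [h0]; exact hω
  rcases eq_or_lt_of_le ht.2 with h | ht1
  · subst h
    refine tendsto_of_tendsto_of_tendsto_of_le_of_le tendsto_const_nhds (hc1 ε hε)
      (fun _ => zero_le) (fun n => measure_mono fun ω hω => ⟨t, ht, ?_⟩)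
    rw [h1]; exact hω
  set d0 := min t (T - t) with hd0
  have hd0p : 0 < d0 := lt_min ht0 (by linarith)
  have hd0t : d0 ≤ t := min_le_left _ _
  have hd0T : d0 ≤ T - t := min_le_right _ _
  set d : ℕ → ℝ := fun k => d0 * (1 / ((k : ℝ) + 1)) with hd
  have hdp : ∀ k, 0 < d k := fun k => by positivity
  have hdanti : Antitone d := fun k l hkl =>
    mul_le_mul_of_nonneg_left (Nat.one_div_le_one_div hkl) hd0p.le
  have hdle : ∀ k, d k ≤ d0 := fun k => by
    have := hdanti (Nat.zero_le k)
    simpa [hd] using this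
  have hdlim : Tendsto d atTop (𝓝 0) := by
    simpa [hd] using (tendsto_one_div_add_atTop_nhds_zero_nat (𝕜 := ℝ)).const_mul d0
  set F : ℕ → Set Ω := fun k => {ω | ∃ r ∈ Ioo (t - d k) (t + d k), ε/4 < |X r ω - X t ω|} with hF
  have hFm : ∀ k, MeasurableSet (F k) := by
    intro k
    have : F k = ⋃ q : ℚ, ⋃ (_ : (q : ℝ) ∈ Ioo (t - d k) (t + d k)),
        (fun ω => |X q ω - X t ω|) ⁻¹' (Ioi (ε/4)) := by
      ext ω
      simp only [hF, mem_ofPred_eq, mem_iUnion, mem_preimage]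
      rw [cad_rat (T := T) (f := fun r => |X r ω - X t ω|)
        (fun u hu => (((hX ω).1 u hu).sub_const _).abs)
        (by linarith [hdle k]) (by linarith [hdle k])]
      simp
    rw [this]
    refine MeasurableSet.iUnion fun q => MeasurableSet.iUnion fun _ => ?_
    exact ((hXm q).sub (hXm t)).abs measurableSet_Ioi
  have hFa : Antitone F := by
    rintro k l hkl ω ⟨r, hr, h⟩
    have := hdanti hkl
    exact ⟨r, ⟨by linarith [hr.1], by linarith [hr.2]⟩, h⟩
  have hlim := tendsto_measure_iInter_atTop (μ := P) (fun k => (hFm k).nullMeasurableSet)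
    hFa ⟨0, measure_ne_top _ _⟩
  have hz : P (⋂ k, F k) = 0 := by
    refine measure_mono_null ?_ hj
    intro ω hω hcon
    have hc := contAt hX ⟨ht0, ht1⟩ hcon
    obtain ⟨δ, hδ, hδ'⟩ := Metric.continuousAt_iff.1 hc (ε/4) (by linarith)
    obtain ⟨k, hk⟩ := (hdlim.eventually (gt_mem_nhds hδ)).exists
    obtain ⟨r, hr, h⟩ := mem_iInter.1 hω k
    have := @hδ' r (by
      rw [Real.dist_eq, abs_lt]; constructor <;> linarith [hr.1, hr.2])
    rw [Real.dist_eq] at this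
    linarith
  rw [hz] at hlim
  rw [ENNReal.tendsto_nhds_zero]
  intro η hη
  obtain ⟨k, hk⟩ := (ENNReal.tendsto_nhds_zero.1 hlim (η/3) (third_pos hη)).exists
  filter_upwards [ENNReal.tendsto_nhds_zero.1 (hc1 (ε/4) (by linarith)) (η/3) (third_pos hη),
    ENNReal.tendsto_nhds_zero.1 (hc2 (d k) (hdp k)) (η/3) (third_pos hη)] with n hn1 hn2
  refine three P ?_ hk hn1 hn2
  intro ω hω
  by_contra hcon
  simp only [mem_union, not_or] at hcon
  obtain ⟨⟨hA, hB⟩, hC⟩ := hcon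
  simp only [hF, mem_ofPred_eq, not_exists, not_and, not_le, not_lt] at hA hB hC hω
  obtain ⟨r, hr, hrt⟩ := exists_preimage hT (hΛc n ω) (h0 n ω) (h1 n ω) ht
  have e1 := hB r hr
  have e2 := hC r hr
  rw [hrt] at e1 e2
  rw [abs_lt] at e2
  have e3 := hA r ⟨by linarith, by linarith⟩
  have := abs_sub_le (Xn n t ω) (X r ω) (X t ω)
  linarith

lemma E_approx (hT : 0 < T) (hXm : ∀ s : ℝ, Measurable (X s))
    (hX : ∀ ω, IsCadlagOn T (fun t => X t ω))
    (hXn : ∀ n ω, IsCadlagOn T (fun t => Xn n t ω)) (hconv : SkorokhodTendstoP P T Xn X)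
    {a b c t : ℝ} (ha : 0 ≤ a) (hb : b ≤ T) (hbt : b ≤ t) :
    MeasurableSet[approxSA P (fun n => natFilt (Xn n) t)] {ω | ∃ r ∈ Ioo a b, c < X r ω} := by
  obtain ⟨Λ, hΛc, hΛm, h0, h1, hmap, hc1, hc2⟩ := hconv
  have hEm : MeasurableSet {ω | ∃ r ∈ Ioo a b, c < X r ω} :=
    natFilt_le hXm _ _ (meas_E hX ha hb hbt)
  refine ⟨hEm, ?_⟩
  set d : ℕ → ℝ := fun k => (1 / ((k : ℝ) + 1)) with hd
  have hdp : ∀ k, 0 < d k := fun k => by positivity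
  have hdanti : Antitone d := fun k l hkl => Nat.one_div_le_one_div hkl
  have hdlim : Tendsto d atTop (𝓝 0) := tendsto_one_div_add_atTop_nhds_zero_nat (𝕜 := ℝ)
  set E : ℕ → Set Ω := fun k => {ω | ∃ r ∈ Ioo (a + d k) (b - d k), c + d k < X r ω} with hE
  set F : ℕ → Set Ω := fun k => {ω | ∃ r ∈ Ioo a b, c < X r ω} \ E k with hF
  have hFm : ∀ k, MeasurableSet (F k) := fun k => hEm.diff
    (natFilt_le hXm _ _ (meas_E hX (by linarith [hdp k]) (by linarith [hdp k])
      (show b - d k ≤ t by linarith [hdp k])))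
  have hFa : Antitone F := by
    intro k l hkl
    refine sdiff_subset_sdiff_right ?_
    rintro ω ⟨r, hr, h⟩
    have := hdanti hkl
    exact ⟨r, ⟨by linarith [hr.1], by linarith [hr.2]⟩, by linarith⟩
  have hlim := tendsto_measure_iInter_atTop (μ := P) (fun k => (hFm k).nullMeasurableSet)
    hFa ⟨0, measure_ne_top _ _⟩
  have hz : (⋂ k, F k) = ∅ := by
    rw [eq_empty_iff_forall_notMem]
    intro ω hω
    rw [mem_iInter] at hω
    obtain ⟨r, hr, h⟩ := (hω 0).1
    obtain ⟨k, hk1, hk2, hk3⟩ := ((hdlim.eventually (gt_mem_nhds (sub_pos.2 hr.1))).and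
      ((hdlim.eventually (gt_mem_nhds (sub_pos.2 hr.2))).and
      (hdlim.eventually (gt_mem_nhds (sub_pos.2 h))))).exists
    exact (hω k).2 ⟨r, ⟨by linarith, by linarith⟩, by linarith⟩
  rw [hz, measure_empty] at hlim
  intro η hη
  obtain ⟨k, hk⟩ := (ENNReal.tendsto_nhds_zero.1 hlim (η/3) (third_pos hη)).exists
  have hdk := hdp k
  filter_upwards [ENNReal.tendsto_nhds_zero.1 (hc1 (d k/2) (by linarith)) (η/3) (third_pos hη),
    ENNReal.tendsto_nhds_zero.1 (hc2 (d k/2) (by linarith)) (η/3) (third_pos hη)] with n hn1 hn2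
  refine ⟨{ω | ∃ r ∈ Ioo (a + d k / 2) (b - d k / 2), c + d k / 2 < Xn n r ω},
    meas_E (hXn n) (by linarith) (by linarith) (by linarith), ?_⟩
  refine three P ?_ hk hn1 hn2
  intro ω hω
  by_contra hcon
  simp only [mem_union, not_or] at hcon
  obtain ⟨⟨hA, hB⟩, hC⟩ := hcon
  simp only [mem_ofPred_eq, not_exists, not_and, not_le] at hB hC
  rw [mem_symmDiff] at hω
  rcases hω with ⟨hω, hω'⟩ | ⟨hω, hω'⟩
  · have : ω ∈ E k := by
      by_contra h
      exact hA ⟨hω, h⟩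
    obtain ⟨r, hr, h⟩ := this
    have hrT : r ∈ Icc 0 T := ⟨by linarith [hr.1], by linarith [hr.2]⟩
    have e1 := abs_lt.1 (hB r hrT)
    have e2 := abs_lt.1 (hC r hrT)
    exact hω' ⟨Λ n ω r, ⟨by linarith [hr.1], by linarith [hr.2]⟩, by linarith⟩
  · obtain ⟨u, hu, h⟩ := hω
    obtain ⟨r, hr, rfl⟩ := exists_preimage hT (hΛc n ω) (h0 n ω) (h1 n ω)
      (t := u) ⟨by linarith [hu.1], by linarith [hu.2]⟩
    have e1 := abs_lt.1 (hB r hr)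
    have e2 := abs_lt.1 (hC r hr)
    exact hω' ⟨r, ⟨by linarith [hu.1], by linarith [hu.2]⟩, by linarith⟩

lemma natFilt_le_approx (hT : 0 < T) (hXm : ∀ s : ℝ, Measurable (X s))
    (hX : ∀ ω, IsCadlagOn T (fun t => X t ω))
    (hXn : ∀ n ω, IsCadlagOn T (fun t => Xn n t ω)) (hconv : SkorokhodTendstoP P T Xn X)
    {t : ℝ} (ht : t ∈ Icc 0 T) (hj : P {ω | pathJump (fun r => X r ω) t ≠ 0} = 0) :
    natFilt X t ≤ approxSA P (fun n => natFilt (Xn n) t) := by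
  refine iSup₂_le fun u hu => ?_
  refine measurable_iff_comap_le.1 ?_
  rcases eq_or_lt_of_le hu.2 with h | hut
  · subst h
    refine @measurable_of_Ioi _ _ _ _ _ (approxSA P (fun n => natFilt (Xn n) u)) _ _ _ _ ?_
    intro a
    refine ⟨hXm u measurableSet_Ioi, fun η hη => ?_⟩
    set d : ℕ → ℝ := fun k => (1 / ((k : ℝ) + 1)) with hd
    have hdp : ∀ k, 0 < d k := fun k => by positivity
    have hdanti : Antitone d := fun k l hkl => Nat.one_div_le_one_div hkl
    have hdlim : Tendsto d atTop (𝓝 0) := tendsto_one_div_add_atTop_nhds_zero_nat (𝕜 := ℝ)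
    have hlim := tendsto_measure_iInter_atTop (μ := P) (s := fun k => X u ⁻¹' (Ioc a (a + d k)))
      (fun k => (hXm u measurableSet_Ioc).nullMeasurableSet)
      (fun k l hkl => preimage_mono (Ioc_subset_Ioc_right (by linarith [hdanti hkl])))
      ⟨0, measure_ne_top _ _⟩
    have hz : (⋂ k, X u ⁻¹' (Ioc a (a + d k))) = ∅ := by
      rw [eq_empty_iff_forall_notMem]
      intro ω hω
      rw [mem_iInter] at hω
      have h0 : a < X u ω := (hω 0).1
      obtain ⟨k, hk⟩ := (hdlim.eventually (gt_mem_nhds (sub_pos.2 h0))).exists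
      have : X u ω ≤ a + d k := (hω k).2
      linarith
    rw [hz, measure_empty] at hlim
    obtain ⟨k, hk⟩ := (ENNReal.tendsto_nhds_zero.1 hlim (η/3) (third_pos hη)).exists
    have hdk := hdp k
    filter_upwards [ENNReal.tendsto_nhds_zero.1 (conv_at hT hXm hX hconv ht hj
      (half_pos hdk)) (η/3) (third_pos hη)] with n hn
    refine ⟨Xn n u ⁻¹' (Ioi (a + d k / 2)),
      meas_natFilt (Xn n) ⟨hu.1, le_rfl⟩ measurableSet_Ioi, ?_⟩
    refine three P (C := ∅) ?_ hk hn (by simp)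
    intro ω hω
    by_contra hcon
    simp only [mem_union, not_or, mem_preimage, mem_Ioc, mem_ofPred_eq, not_le, not_and,
      mem_symmDiff, mem_Ioi, not_lt] at hcon hω
    have e := abs_lt.1 hcon.1.2
    rcases hω with ⟨h1, h2⟩ | ⟨h1, h2⟩
    · have := hcon.1.1 h1
      linarith
    · linarith
  · refine @measurable_of_Ici _ _ _ _ _ (approxSA P (fun n => natFilt (Xn n) t)) _ _ _ _ ?_
    intro a
    have : X u ⁻¹' (Ici a) = ⋂ k : ℕ, ⋂ j : ℕ, {ω | ∃ r ∈ Ioo u (u + (t - u) * (1 / ((k:ℝ)+1))),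
        a - 1 / ((j:ℝ)+1) < X r ω} := by
      ext ω
      simp only [mem_preimage, mem_Ici, mem_iInter, mem_ofPred_eq]
      have hr := (hX ω).1 u ⟨hu.1, hut.trans_le ht.2⟩
      constructor
      · intro h k j
        have hp : 0 < 1 / ((j:ℝ)+1) := by positivity
        have hp' : 0 < (t - u) * (1 / ((k:ℝ)+1)) := mul_pos (by linarith) (by positivity)
        obtain ⟨r, h1, h2⟩ := ((hr.eventually (lt_mem_nhds
          (show a - 1 / ((j:ℝ)+1) < X u ω by linarith))).and
          (Ioo_mem_nhdsGT (show u < u + (t - u) * (1 / ((k:ℝ)+1)) by linarith))).exists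
        exact ⟨r, h2, h1⟩
      · intro h
        by_contra! hcon
        obtain ⟨j, hj⟩ := ((tendsto_one_div_add_atTop_nhds_zero_nat (𝕜 := ℝ)).eventually
          (gt_mem_nhds (half_pos (sub_pos.2 hcon)))).exists
        have h1 := hr.eventually (gt_mem_nhds (show X u ω < a - 1 / ((j:ℝ)+1) by linarith))
        obtain ⟨v, hv, hv'⟩ := (mem_nhdsGT_iff_exists_Ioo_subset' hut).1 h1
        have hl : Tendsto (fun k : ℕ => u + (t - u) * (1 / ((k:ℝ)+1))) atTop (𝓝 u) := by
          simpa using ((tendsto_one_div_add_atTop_nhds_zero_nat (𝕜 := ℝ)).const_mul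
            (t - u)).const_add u
        obtain ⟨k, hk⟩ := (hl.eventually (gt_mem_nhds hv)).exists
        obtain ⟨r, h2, h3⟩ := h k j
        have : X r ω < a - 1 / ((j:ℝ)+1) := hv' ⟨h2.1, h2.2.trans hk⟩
        linarith
    rw [this]
    refine MeasurableSet.iInter fun k => MeasurableSet.iInter fun j => ?_
    have hle : u + (t - u) * (1 / ((k:ℝ)+1)) ≤ t := by
      have : 1 / ((k:ℝ)+1) ≤ 1 := by
        rw [div_le_one (by positivity)]; linarith [Nat.cast_nonneg (α := ℝ) k]
      nlinarith
    exact E_approx hT hXm hX hXn hconv hu.1 (hle.trans ht.2) hle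

end main

lemma gain_conv {Ω : Type*} [MeasurableSpace Ω] {P : Measure Ω} [IsProbabilityMeasure P]
    {Yn : ℕ → Ω → ℝ} {Y : Ω → ℝ} (hYn : ∀ n, Measurable (Yn n)) (hY : Measurable Y)
    (h : ∀ ε : ℝ, 0 < ε → Tendsto (fun n => P {ω | ε ≤ |Yn n ω - Y ω|}) atTop (𝓝 0))
    {g : ℝ → ℝ} (hg : Continuous g) {C : ℝ} (hC : ∀ y, |g y| ≤ C) :
    Tendsto (fun n => ∫ ω, |g (Yn n ω) - g (Y ω)| ∂P) atTop (𝓝 0) := by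
  have hm : TendstoInMeasure P Yn atTop Y := by
    rw [tendstoInMeasure_iff_norm]
    exact h
  refine tendsto_of_subseq_tendsto fun ns hns => ?_
  obtain ⟨ms, -, hms⟩ := (hm.comp hns).exists_seq_tendsto_ae
  refine ⟨ms, ?_⟩
  have := tendsto_integral_of_dominated_convergence (μ := P) (f := fun _ => (0:ℝ))
    (F := fun n ω => |g (Yn (ns (ms n)) ω) - g (Y ω)|) (fun _ => 2 * C)
    (fun n => ((hg.measurable.comp (hYn _)).sub
      (hg.measurable.comp hY)).abs.aestronglyMeasurable)
    (integrable_const _)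
    (fun n => Eventually.of_forall fun ω => by
      rw [Real.norm_eq_abs, abs_abs]
      have := abs_sub (g (Yn (ns (ms n)) ω)) (g (Y ω))
      linarith [hC (Yn (ns (ms n)) ω), hC (Y ω)])
    (by
      filter_upwards [hms] with ω hω
      have h1 : Tendsto (fun n => g (Yn (ns (ms n)) ω)) atTop (𝓝 (g (Y ω))) :=
        (hg.tendsto _).comp hω
      simpa using (h1.sub_const (g (Y ω))).abs)
  simpa using this

lemma gain_meas {Ω : Type*} [MeasurableSpace Ω] {Y : ℝ → Ω → ℝ} (hY : ∀ t, Measurable (Y t))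
    {γ : ℝ → ℝ → ℝ} {S : Finset ℝ} (hγ : ∀ u ∈ S, Measurable (γ u)) {τ : Ω → ℝ}
    (hτ : Measurable τ) (hS : ∀ ω, τ ω ∈ S) : Measurable (fun ω => γ (τ ω) (Y (τ ω) ω)) := by
  have : (fun ω => γ (τ ω) (Y (τ ω) ω)) = fun ω =>
      ∑ u ∈ S, (τ ⁻¹' {u}).indicator (fun ω => γ u (Y u ω)) ω := by
    funext ω
    rw [Finset.sum_eq_single (τ ω)]
    · simp
    · intro u _ hu
      rw [indicator_of_notMem]
      simpa using hu.symm
    · intro h; exact absurd (hS ω) h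
  rw [this]
  exact Finset.measurable_fun_sum _ fun u hu =>
    ((hγ u hu).comp (hY u)).indicator (hτ (measurableSet_singleton u))

lemma stopping_meas {Ω : Type*} [m : MeasurableSpace Ω] {F : ℝ → MeasurableSpace Ω}
    (hF : ∀ t, F t ≤ m) {τ : Ω → ℝ} (hτ : IsStoppingTimeOn F τ) : Measurable τ :=
  measurable_of_Iic fun t => hF t _ (hτ t)

open Classical in
/-- First element of `S` whose set `B u` contains `ω`, or `L`. -/
noncomputable def firstB {Ω : Type*} (S : Finset ℝ) (L : ℝ) (B : ℝ → Set Ω) (ω : Ω) : ℝ :=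
  if h : (S.filter (fun u => ω ∈ B u)).Nonempty then (S.filter (fun u => ω ∈ B u)).min' h else L

lemma firstB_mem {Ω : Type*} (S : Finset ℝ) (L : ℝ) (B : ℝ → Set Ω) (ω : Ω) :
    firstB S L B ω ∈ insert L S := by
  classical
  unfold firstB
  split_ifs with h
  · have := Finset.min'_mem _ h
    rw [Finset.mem_filter] at this
    convert Finset.mem_insert_of_mem this.1
  · simp

lemma firstB_eq {Ω : Type*} {S : Finset ℝ} {L : ℝ} {B : ℝ → Set Ω} {ω : Ω} {v : ℝ} (hv : v ∈ S)
    (h : ∀ u ∈ S, (ω ∈ B u ↔ v = u)) : firstB S L B ω = v := by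
  classical
  have h1 : S.filter (fun u => ω ∈ B u) = {v} := by
    ext u
    simp only [Finset.mem_filter, Finset.mem_singleton]
    constructor
    · rintro ⟨h1, h2⟩; exact ((h u h1).1 h2).symm
    · rintro rfl; exact ⟨hv, (h _ hv).2 rfl⟩
  unfold firstB
  have h2 : (S.filter (fun u => ω ∈ B u)).Nonempty := by rw [h1]; simp
  rw [dif_pos (by convert h2)]
  have := Finset.min'_mem _ h2
  have h3 := Finset.mem_filter.1 this
  exact ((h _ h3.1).1 h3.2).symm

lemma firstB_le {Ω : Type*} {S : Finset ℝ} {L : ℝ} {B : ℝ → Set Ω} {ω : Ω} {t : ℝ} (ht : t < L) :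
    firstB S L B ω ≤ t ↔ ∃ u ∈ S, u ≤ t ∧ ω ∈ B u := by
  classical
  unfold firstB
  split_ifs with h
  · constructor
    · intro h'
      have h3 := Finset.mem_filter.1 (Finset.min'_mem _ h)
      exact ⟨_, h3.1, h', h3.2⟩
    · rintro ⟨u, h1, h3, h2⟩
      exact (Finset.min'_le _ u (Finset.mem_filter.2 ⟨h1, h2⟩)).trans h3
  · constructor
    · intro h'; linarith
    · rintro ⟨u, h1, h3, h2⟩
      exact absurd ⟨u, Finset.mem_filter.2 ⟨h1, h2⟩⟩ h

lemma firstB_isStopping {Ω : Type*} {Y : ℝ → Ω → ℝ} {S : Finset ℝ} {L : ℝ} {B : ℝ → Set Ω}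
    (hS : ∀ u ∈ S, u ≤ L) (hB : ∀ u ∈ S, MeasurableSet[natFilt Y u] (B u)) :
    IsStoppingTimeOn (natFilt Y) (firstB S L B) := by
  intro t
  rcases lt_or_ge t L with ht | ht
  · have : {ω | firstB S L B ω ≤ t} = ⋃ u ∈ S, ⋃ (_ : u ≤ t), B u := by
      ext ω
      simp only [mem_ofPred_eq, firstB_le ht, mem_iUnion, exists_prop]
    rw [this]
    refine Finset.measurableSet_biUnion _ fun u hu => MeasurableSet.iUnion fun hut => ?_
    exact natFilt_mono Y hut _ (hB u hu)
  · have : {ω | firstB S L B ω ≤ t} = univ := by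
      ext ω
      simp only [mem_ofPred_eq, mem_univ, iff_true]
      rcases Finset.mem_insert.1 (firstB_mem S L B ω) with h | h
      · rw [h]; exact ht
      · exact (hS _ h).trans ht
    rw [this]
    exact MeasurableSet.univ

lemma stopping_eq_meas {Ω : Type*} {Y : ℝ → Ω → ℝ} {τ : Ω → ℝ} {s : Finset ℝ}
    (hτ : IsStoppingTimeOn (natFilt Y) τ) (hs : ∀ ω, τ ω ∈ s) (u : ℝ) :
    MeasurableSet[natFilt Y u] {ω | τ ω = u} := by
  have : {ω | τ ω = u} = {ω | τ ω ≤ u} \ ⋃ v ∈ s, ⋃ (_ : v < u), {ω | τ ω ≤ v} := by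
    ext ω
    simp only [mem_ofPred_eq, Set.mem_sdiff, mem_iUnion, exists_prop, not_exists, not_and, not_le]
    constructor
    · rintro rfl; exact ⟨le_rfl, fun v _ h => h⟩
    · rintro ⟨h1, h2⟩
      by_contra hne
      exact absurd (h2 (τ ω) (hs ω) (lt_of_le_of_ne h1 hne)) (lt_irrefl _)
  rw [this]
  refine (hτ u).diff (Finset.measurableSet_biUnion _ fun v _ => MeasurableSet.iUnion fun h => ?_)
  exact natFilt_mono Y h.le _ (hτ v)

lemma bdd {Ω : Type*} [MeasurableSpace Ω] {P : Measure Ω} [IsProbabilityMeasure P]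
    {γ : ℝ → ℝ → ℝ} {C : ℝ} (hC : ∀ t ∈ Set.Ici (0 : ℝ), ∀ y : ℝ, |γ t y| ≤ C)
    (Y : ℝ → Ω → ℝ) {τ : Ω → ℝ} (h : ∀ ω, 0 ≤ τ ω) : |∫ ω, γ (τ ω) (Y (τ ω) ω) ∂P| ≤ C := by
  have := norm_integral_le_of_norm_le_const (μ := P) (f := fun ω => γ (τ ω) (Y (τ ω) ω)) (C := C)
    (Eventually.of_forall fun ω => hC _ (h ω) _)
  simpa using this

lemma zero_isStopping {Ω : Type*} (Y : ℝ → Ω → ℝ) :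
    IsStoppingTimeOn (natFilt Y) (fun _ => (0:ℝ)) := by
  intro t
  exact MeasurableSet.const _

lemma core {Ω : Type*} [MeasurableSpace Ω] {P : Measure Ω} [IsProbabilityMeasure P]
    {T L : ℝ} (hT : 0 < T) (hL : L ∈ Set.Icc 0 T) {γ : ℝ → ℝ → ℝ}
    (hγc : ∀ u, 0 ≤ u → Continuous (γ u))
    {C : ℝ} (hC0 : 0 ≤ C) (hC : ∀ t ∈ Set.Ici (0 : ℝ), ∀ y : ℝ, |γ t y| ≤ C)
    {X : ℝ → Ω → ℝ} {Xn : ℕ → ℝ → Ω → ℝ}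
    (hXm : ∀ s : ℝ, Measurable (X s)) (hXnm : ∀ n, ∀ s : ℝ, Measurable (Xn n s))
    (hXcad : ∀ ω, IsCadlagOn T (fun t => X t ω))
    (hXncad : ∀ n ω, IsCadlagOn T (fun t => Xn n t ω))
    (hconv : SkorokhodTendstoP P T Xn X)
    {s : Finset ℝ} (hssub : ↑s ⊆ Set.Icc (0 : ℝ) T)
    (hscont : ∀ u ∈ s, P {ω | pathJump (fun r => X r ω) u ≠ 0} = 0)
    {τ : Ω → ℝ} (hτ : IsStoppingTimeOn (natFilt X) τ) (hτL : ∀ ω, τ ω ∈ Set.Icc 0 L)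
    (hτs : ∀ ω, τ ω ∈ s) {η : ℝ} (hη : 0 < η) :
    ∀ᶠ n in atTop, ∫ ω, γ (τ ω) (X (τ ω) ω) ∂P - η ≤
      optValue P (natFilt (Xn n)) (Xn n) γ L := by
  classical
  set S := s.filter (fun u => u ≤ L) with hS
  have hSs : ∀ u ∈ S, u ∈ s := fun u hu => (Finset.mem_filter.1 hu).1
  have hSL : ∀ u ∈ S, u ≤ L := fun u hu => (Finset.mem_filter.1 hu).2
  have hST : ∀ u ∈ S, u ∈ Icc 0 T := fun u hu => hssub (hSs u hu)
  have hτS : ∀ ω, τ ω ∈ S := fun ω => Finset.mem_filter.2 ⟨hτs ω, (hτL ω).2⟩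
  have h1 : Tendsto (fun n => ∑ u ∈ S, ∫ ω, |γ u (Xn n u ω) - γ u (X u ω)| ∂P) atTop (𝓝 0) := by
    have : Tendsto (fun n => ∑ u ∈ S, ∫ ω, |γ u (Xn n u ω) - γ u (X u ω)| ∂P) atTop
        (𝓝 (∑ u ∈ S, 0)) := by
      refine tendsto_finsetSum _ fun u hu => ?_
      exact gain_conv (fun n => hXnm n u) (hXm u)
        (fun ε hε => conv_at hT hXm hXcad hconv (hST u hu) (hscont u (hSs u hu)) hε)
        (hγc u (hST u hu).1) (hC u (hST u hu).1)
    simpa using this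
  set ε : ℝ := η / (4 * (C + 1) * (S.card + 1)) with hε
  have hεp : 0 < ε := by positivity
  have h2 : ∀ᶠ n in atTop, ∀ u ∈ S, ∃ B, MeasurableSet[natFilt (Xn n) u] B ∧
      P (symmDiff {ω | τ ω = u} B) ≤ ENNReal.ofReal ε := by
    rw [Filter.eventually_all_finset]
    intro u hu
    exact (natFilt_le_approx hT hXm hXcad hXncad hconv (hST u hu) (hscont u (hSs u hu)) _
      (stopping_eq_meas hτ hτs u)).2 _ (ENNReal.ofReal_pos.2 hεp)
  filter_upwards [h1.eventually (gt_mem_nhds (half_pos hη)), h2] with n hn1 hn2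
  choose! B hBm hB using hn2
  set σ := firstB S L B with hσ
  have hσst : IsStoppingTimeOn (natFilt (Xn n)) σ := firstB_isStopping hSL hBm
  have hσmem : ∀ ω, σ ω ∈ insert L S := firstB_mem S L B
  have hσL : ∀ ω, σ ω ∈ Icc 0 L := by
    intro ω
    rcases Finset.mem_insert.1 (hσmem ω) with h | h
    · rw [h]; exact ⟨hL.1, le_rfl⟩
    · exact ⟨(hST _ h).1, hSL _ h⟩
  have hle : ∫ ω, γ (σ ω) (Xn n (σ ω) ω) ∂P ≤ optValue P (natFilt (Xn n)) (Xn n) γ L := by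
    refine le_csSup ⟨C, ?_⟩ ⟨σ, hσst, hσL, rfl⟩
    rintro x ⟨ρ, -, hρ, rfl⟩
    exact (le_abs_self _).trans (bdd hC _ fun ω => (hρ ω).1)
  refine le_trans ?_ hle
  set D : Set Ω := ⋃ u ∈ S, symmDiff {ω | τ ω = u} (B u) with hD
  have hDm : MeasurableSet D := Finset.measurableSet_biUnion _ fun u hu =>
    MeasurableSet.symmDiff (natFilt_le hXm u _ (stopping_eq_meas hτ hτs u))
      (natFilt_le (hXnm n) u _ (hBm u hu))
  have hDP : P.real D ≤ S.card * ε := by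
    have : P D ≤ ENNReal.ofReal (S.card * ε) := by
      calc P D ≤ ∑ u ∈ S, P (symmDiff {ω | τ ω = u} (B u)) := measure_biUnion_finset_le _ _
        _ ≤ ∑ u ∈ S, ENNReal.ofReal ε := Finset.sum_le_sum hB
        _ = ENNReal.ofReal (S.card * ε) := by
          rw [Finset.sum_const, nsmul_eq_mul, ENNReal.ofReal_mul (by positivity)]
          simp
    exact ENNReal.toReal_le_of_le_ofReal (by positivity) this
  have hγm : ∀ u ∈ insert L S, Measurable (γ u) := by
    intro u hu
    refine (hγc u ?_).measurable
    rcases Finset.mem_insert.1 hu with h | h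
    · rw [h]; exact hL.1
    · exact (hST _ h).1
  have hint : ∀ (Y : ℝ → Ω → ℝ) (ρ : Ω → ℝ), (∀ t, Measurable (Y t)) → Measurable ρ →
      (∀ ω, ρ ω ∈ insert L S) → (∀ ω, 0 ≤ ρ ω) →
      Integrable (fun ω => γ (ρ ω) (Y (ρ ω) ω)) P := by
    intro Y ρ hY hρ hρS h0
    exact Integrable.of_bound (gain_meas hY hγm hρ hρS).aestronglyMeasurable C
      (Eventually.of_forall fun ω => hC _ (h0 ω) _)
  have hi1 := hint X τ hXm (stopping_meas (natFilt_le hXm) hτ)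
    (fun ω => Finset.mem_insert_of_mem (hτS ω)) (fun ω => (hτL ω).1)
  have hi2 := hint (Xn n) σ (hXnm n) (stopping_meas (natFilt_le (hXnm n)) hσst) hσmem
    (fun ω => (hσL ω).1)
  have hi3 : ∀ u ∈ S, Integrable (fun ω => |γ u (Xn n u ω) - γ u (X u ω)|) P := by
    intro u hu
    have h0 := (hST u hu).1
    have hm := (hγc u h0).measurable
    exact ((Integrable.of_bound (hm.comp (hXnm n u)).aestronglyMeasurable C
      (Eventually.of_forall fun ω => hC u h0 _)).sub
      (Integrable.of_bound (hm.comp (hXm u)).aestronglyMeasurable C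
      (Eventually.of_forall fun ω => hC u h0 _))).abs
  have hi4 : Integrable (D.indicator (fun _ => 2 * C)) P :=
    (integrable_const _).indicator hDm
  have hi5 : Integrable (fun ω => ∑ u ∈ S, |γ u (Xn n u ω) - γ u (X u ω)|) P :=
    integrable_finsetSum _ hi3
  have hpt : ∀ ω, γ (τ ω) (X (τ ω) ω) ≤ γ (σ ω) (Xn n (σ ω) ω) +
      (∑ u ∈ S, |γ u (Xn n u ω) - γ u (X u ω)| + D.indicator (fun _ => 2 * C) ω) := by
    intro ω
    have hnn : ∀ u ∈ S, 0 ≤ |γ u (Xn n u ω) - γ u (X u ω)| := fun _ _ => abs_nonneg _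
    by_cases hω : ω ∈ D
    · rw [indicator_of_mem hω]
      have e1 := abs_le.1 (hC (τ ω) (hτL ω).1 (X (τ ω) ω))
      have e2 := abs_le.1 (hC (σ ω) (hσL ω).1 (Xn n (σ ω) ω))
      have e3 := Finset.sum_nonneg hnn
      linarith [e1.2, e2.1]
    · rw [indicator_of_notMem hω]
      have : σ ω = τ ω := by
        refine firstB_eq (hτS ω) fun u hu => ?_
        have : ω ∉ symmDiff {ω | τ ω = u} (B u) := fun h => hω (mem_biUnion hu h)
        rw [mem_symmDiff] at this
        simp only [mem_ofPred_eq] at this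
        tauto
      rw [this]
      have e1 := Finset.single_le_sum hnn (hτS ω)
      have e2 := neg_abs_le (γ (τ ω) (Xn n (τ ω) ω) - γ (τ ω) (X (τ ω) ω))
      linarith
  have hfin := integral_mono hi1 (hi2.add (hi5.add hi4)) hpt
  have heq : ∫ ω, (γ (σ ω) (Xn n (σ ω) ω) +
      (∑ u ∈ S, |γ u (Xn n u ω) - γ u (X u ω)| + D.indicator (fun _ => 2 * C) ω)) ∂P =
      ∫ ω, γ (σ ω) (Xn n (σ ω) ω) ∂P +
      (∑ u ∈ S, ∫ ω, |γ u (Xn n u ω) - γ u (X u ω)| ∂P + P.real D * (2 * C)) := by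
    have e1 := integral_add hi2 (hi5.add hi4)
    have e2 := integral_add hi5 hi4
    refine e1.trans ?_
    congr 1
    refine e2.trans ?_
    rw [integral_finsetSum _ hi3,
      integral_indicator hDm, setIntegral_const, smul_eq_mul]
  have hfin2 := hfin.trans_eq heq
  have hb : P.real D * (2 * C) ≤ η / 2 := by
    calc P.real D * (2 * C) ≤ (S.card * ε) * (2 * C) := by gcongr
      _ ≤ ((S.card + 1) * ε) * (2 * (C + 1)) := by gcongr <;> linarith
      _ = η / 2 := by rw [hε]; field_simp; ring
  linarith

end SubdivAux

/-- (Lemma `Γ^π(L) ≤ liminf Γₙ(L)`.) For a finite subdivision `s`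
of `[0,T]` made of continuity points of `X`, the optimal value over stopping times
with values in `s` is at most `liminf Γₙ(L)`. -/
theorem subdivision_value_le_liminf_values
    {Ω : Type*} [MeasurableSpace Ω] (P : Measure Ω) [IsProbabilityMeasure P]
    (T L : ℝ) (hT : 0 < T) (hL : L ∈ Set.Icc 0 T)
    (γ : ℝ → ℝ → ℝ)
    (hγc : ContinuousOn (fun p : ℝ × ℝ => γ p.1 p.2) (Set.Ici 0 ×ˢ Set.univ))
    (hγb : ∃ C : ℝ, ∀ t ∈ Set.Ici (0 : ℝ), ∀ y : ℝ, |γ t y| ≤ C)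
    (X : ℝ → Ω → ℝ) (Xn : ℕ → ℝ → Ω → ℝ)
    (hXm : ∀ s : ℝ, Measurable (X s)) (hXnm : ∀ n, ∀ s : ℝ, Measurable (Xn n s))
    (hXcad : ∀ ω, IsCadlagOn T (fun t => X t ω))
    (hXncad : ∀ n ω, IsCadlagOn T (fun t => Xn n t ω))
    (hXL : P {ω | pathJump (fun r => X r ω) L ≠ 0} = 0)
    (hconv : SkorokhodTendstoP P T Xn X)
    (s : Finset ℝ) (hs0 : (0 : ℝ) ∈ s) (hsT : T ∈ s) (hssub : ↑s ⊆ Set.Icc (0 : ℝ) T)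
    (hscont : ∀ u ∈ s, P {ω | pathJump (fun r => X r ω) u ≠ 0} = 0) :
    optValueIn P (natFilt X) X γ L s ≤
      Filter.liminf (fun n => optValue P (natFilt (Xn n)) (Xn n) γ L) Filter.atTop := by
  obtain ⟨C, hC⟩ := hγb
  have hC0 : 0 ≤ C := (abs_nonneg _).trans (hC 0 (by simp) 0)
  have hγc' : ∀ u, 0 ≤ u → Continuous (γ u) := by
    intro u hu
    rw [← continuousOn_univ]
    exact hγc.comp (f := fun y : ℝ => ((u, y) : ℝ × ℝ)) (by fun_prop)
      (fun y _ => ⟨hu, Set.mem_univ _⟩)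
  refine csSup_le ⟨_, fun _ => 0, SubdivAux.zero_isStopping X, fun _ => ⟨le_rfl, hL.1⟩,
    fun _ => hs0, rfl⟩ ?_
  rintro x ⟨τ, hτ, hτL, hτs, rfl⟩
  refine le_of_forall_sub_le fun η hη => ?_
  refine le_liminf_of_le ?_ (SubdivAux.core hT hL hγc' hC0 hC hXm hXnm hXcad hXncad hconv hssub
    hscont hτ hτL hτs hη)
  refine IsBoundedUnder.isCoboundedUnder_ge ⟨C, eventually_map.2 (Eventually.of_forall fun n => ?_)⟩
  refine csSup_le ⟨_, fun _ => 0, SubdivAux.zero_isStopping (Xn n), fun _ => ⟨le_rfl, hL.1⟩, rfl⟩ ?_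
  rintro x ⟨ρ, -, hρ, rfl⟩
  exact (le_abs_self _).trans (SubdivAux.bdd hC _ fun ω => (hρ ω).1)
end

section
/- Let X be a càdlàg process with P[ΔX_L ≠ 0] = 0 and natural filtration ℱ^X. Let (πᵏ) be an increasing sequence (πᵏ ⊆ πᵏ⁺¹) of finite subdivisions of [0,T] such that L ∈ πᵏ for every k, P[ΔX_t ≠ 0] = 0 for every t ∈ πᵏ and every k, and the mesh |πᵏ| → 0 as k → ∞. Then Γ^{πᵏ}(L) → Γ(L) as k → ∞, where Γ^{πᵏ}(L) = sup{E[γ(τ, X_τ)] : τ an ℱ^X-stopping time with τ ≤ L taking values in πᵏ} and Γ(L) = sup{E[γ(τ, X_τ)] : τ an ℱ^X-stopping time with τ ≤ L}. -/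
open MeasureTheory Filter Set Topology

theorem natFilt_le_aux {Ω : Type*} [m : MeasurableSpace Ω] (X : ℝ → Ω → ℝ)
    (hXm : ∀ s : ℝ, Measurable (X s)) (t : ℝ) : natFilt X t ≤ m := by
  unfold natFilt
  refine iSup₂_le fun s _ => ?_
  have h := (hXm s).comap_le
  rwa [BorelSpace.measurable_eq (α := ℝ)] at h

theorem natFilt_mono_aux {Ω : Type*} (X : ℝ → Ω → ℝ) {s t : ℝ} (hst : s ≤ t) :
    natFilt X s ≤ natFilt X t := by
  unfold natFilt
  exact biSup_mono fun r hr => ⟨hr.1, hr.2.trans hst⟩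

theorem exists_round_up_aux (s : Finset ℝ) (T : ℝ) (hT : T ∈ s) :
    ∃ ρ : ℝ → ℝ, ∀ x ≤ T, ρ x ∈ s ∧ x ≤ ρ x ∧ ∀ u ∈ s, x ≤ u → ρ x ≤ u := by
  have : ∀ x : ℝ, ∃ y : ℝ, x ≤ T → (y ∈ s ∧ x ≤ y ∧ ∀ u ∈ s, x ≤ u → y ≤ u) := by
    intro x
    by_cases hx : x ≤ T
    · obtain ⟨y, hy, hmin⟩ := (s.filter (fun y => x ≤ y)).exists_min_image id
        ⟨T, by simp [hT, hx]⟩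
      simp only [Finset.mem_filter, id] at hy hmin
      exact ⟨y, fun _ => ⟨hy.1, hy.2, fun u hu hxu => hmin u ⟨hu, hxu⟩⟩⟩
    · exact ⟨0, fun h => absurd h hx⟩
  choose ρ hρ using this
  exact ⟨ρ, hρ⟩

/-- (Lemma `Γ^{πᵏ}(L) → Γ(L)`.) For an increasing sequence of
finite subdivisions `πᵏ` of `[0,T]` containing `L`, made of continuity points of `X`
and with mesh tending to `0`, the optimal values over stopping times with values in
`πᵏ` converge to `Γ(L)`. -/
theorem subdivision_values_tendsto_value
    {Ω : Type*} [MeasurableSpace Ω] (P : Measure Ω) [IsProbabilityMeasure P]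
    (T L : ℝ) (hT : 0 < T) (hL : L ∈ Set.Icc 0 T)
    (γ : ℝ → ℝ → ℝ)
    (hγc : ContinuousOn (fun p : ℝ × ℝ => γ p.1 p.2) (Set.Ici 0 ×ˢ Set.univ))
    (hγb : ∃ C : ℝ, ∀ t ∈ Set.Ici (0 : ℝ), ∀ y : ℝ, |γ t y| ≤ C)
    (X : ℝ → Ω → ℝ)
    (hXm : ∀ s : ℝ, Measurable (X s))
    (hXcad : ∀ ω, IsCadlagOn T (fun t => X t ω))
    (hXL : P {ω | pathJump (fun r => X r ω) L ≠ 0} = 0)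
    (π : ℕ → Finset ℝ)
    (hπsub : ∀ k, ↑(π k) ⊆ Set.Icc (0 : ℝ) T)
    (hπ0 : ∀ k, (0 : ℝ) ∈ π k) (hπT : ∀ k, T ∈ π k) (hπL : ∀ k, L ∈ π k)
    (hπmono : ∀ k, π k ⊆ π (k + 1))
    (hπcont : ∀ k, ∀ u ∈ π k, P {ω | pathJump (fun r => X r ω) u ≠ 0} = 0)
    (hmesh : ∀ δ : ℝ, 0 < δ → ∃ K : ℕ, ∀ k ≥ K, ∀ x ∈ π k, x ≠ T →
      ∃ y ∈ π k, x < y ∧ y ≤ x + δ) :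
    Filter.Tendsto (fun k => optValueIn P (natFilt X) X γ L (π k)) Filter.atTop
      (nhds (optValue P (natFilt X) X γ L)) := by
  obtain ⟨C, hC⟩ := hγb
  have hbound : ∀ τ : Ω → ℝ, (∀ ω, τ ω ∈ Set.Icc 0 L) →
      ∫ ω, γ (τ ω) (X (τ ω) ω) ∂P ≤ C := by
    intro τ hτ
    have h := norm_integral_le_of_norm_le_const (μ := P)
      (f := fun ω => γ (τ ω) (X (τ ω) ω)) (C := C)
      (Eventually.of_forall fun ω => hC _ (hτ ω).1 _)
    simp only [probReal_univ, mul_one] at h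
    exact (le_abs_self _).trans h
  have hconst : IsStoppingTimeOn (natFilt X) (fun _ : Ω => L) := by
    intro t
    exact MeasurableSet.const _
  have hLL : L ∈ Set.Icc 0 L := ⟨hL.1, le_rfl⟩
  have hbdd : BddAbove {x | ∃ τ : Ω → ℝ, IsStoppingTimeOn (natFilt X) τ ∧
      (∀ ω, τ ω ∈ Set.Icc 0 L) ∧ x = ∫ ω, γ (τ ω) (X (τ ω) ω) ∂P} := by
    refine ⟨C, ?_⟩
    rintro x ⟨τ, -, hτ, rfl⟩
    exact hbound τ hτ
  have hbddk : ∀ k, BddAbove {x | ∃ τ : Ω → ℝ, IsStoppingTimeOn (natFilt X) τ ∧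
      (∀ ω, τ ω ∈ Set.Icc 0 L) ∧ (∀ ω, τ ω ∈ π k) ∧
      x = ∫ ω, γ (τ ω) (X (τ ω) ω) ∂P} := by
    intro k
    refine ⟨C, ?_⟩
    rintro x ⟨τ, -, hτ, -, rfl⟩
    exact hbound τ hτ
  have hle : ∀ k, optValueIn P (natFilt X) X γ L (π k) ≤ optValue P (natFilt X) X γ L := by
    intro k
    unfold optValueIn optValue
    refine csSup_le_csSup hbdd ⟨_, fun _ => L, hconst, fun _ => hLL, fun _ => hπL k, rfl⟩ ?_
    rintro x ⟨τ, h1, h2, -, h3⟩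
    exact ⟨τ, h1, h2, h3⟩
  refine tendsto_order.2 ⟨fun a ha => ?_, fun a ha => Eventually.of_forall fun k =>
    (hle k).trans_lt ha⟩
  unfold optValue at ha
  obtain ⟨x, ⟨τ, hτs, hτ, rfl⟩, hax⟩ :=
    exists_lt_of_lt_csSup (by exact ⟨_, fun _ => L, hconst, fun _ => hLL, rfl⟩) ha
  have hround : ∀ k, ∃ ρ : ℝ → ℝ, ∀ x ≤ T,
      ρ x ∈ π k ∧ x ≤ ρ x ∧ ∀ u ∈ π k, x ≤ u → ρ x ≤ u :=
    fun k => exists_round_up_aux (π k) T (hπT k)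
  choose ρ hρ using hround
  have hτT : ∀ ω, τ ω ≤ T := fun ω => (hτ ω).2.trans hL.2
  -- the rounded times are stopping times
  have hst : ∀ k, IsStoppingTimeOn (natFilt X) (fun ω => ρ k (τ ω)) := by
    intro k t
    have heq : {ω | ρ k (τ ω) ≤ t} = ⋃ u ∈ (π k).filter (fun u => u ≤ t), {ω | τ ω ≤ u} := by
      ext ω
      obtain ⟨h1, h2, h3⟩ := hρ k (τ ω) (hτT ω)
      simp only [Set.mem_ofPred_eq, Set.mem_iUnion, Finset.mem_filter, exists_prop]
      constructor
      · intro h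
        exact ⟨ρ k (τ ω), ⟨h1, h⟩, h2⟩
      · rintro ⟨u, ⟨hu, hut⟩, hu'⟩
        exact (h3 u hu hu').trans hut
    rw [heq]
    refine Finset.measurableSet_biUnion _ fun u hu => ?_
    exact natFilt_mono_aux X (Finset.mem_filter.1 hu).2 _ (hτs u)
  have hmem : ∀ k ω, ρ k (τ ω) ∈ π k := fun k ω => (hρ k (τ ω) (hτT ω)).1
  have hge : ∀ k ω, τ ω ≤ ρ k (τ ω) := fun k ω => (hρ k (τ ω) (hτT ω)).2.1
  have hIcc : ∀ k ω, ρ k (τ ω) ∈ Set.Icc 0 L := fun k ω =>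
    ⟨(hτ ω).1.trans (hge k ω), (hρ k (τ ω) (hτT ω)).2.2 L (hπL k) (hτ ω).2⟩
  -- measurability
  have hmeas : ∀ k, Measurable (fun ω => γ (ρ k (τ ω)) (X (ρ k (τ ω)) ω)) := by
    intro k
    have hρm : Measurable (fun ω => ρ k (τ ω)) :=
      measurable_of_Iic fun t => natFilt_le_aux X hXm t _ (hst k t)
    have heq : (fun ω => γ (ρ k (τ ω)) (X (ρ k (τ ω)) ω)) = fun ω => ∑ u ∈ π k,
        {ω | ρ k (τ ω) = u}.indicator (fun ω => γ u (X u ω)) ω := by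
      funext ω
      rw [Finset.sum_eq_single (ρ k (τ ω))]
      · simp
      · intro b _ hb
        refine Set.indicator_of_notMem ?_ _
        intro h
        exact hb (Eq.symm h)
      · intro h
        exact absurd (hmem k ω) h
    rw [heq]
    refine Finset.measurable_sum _ fun u hu => Measurable.indicator ?_ ?_
    · have hu0 : (0 : ℝ) ≤ u := (hπsub k hu).1
      have hcont : Continuous (γ u) := by
        have : ContinuousOn (fun y : ℝ => γ u y) Set.univ :=
          hγc.comp (f := fun y : ℝ => (u, y)) (by fun_prop) (fun y _ => ⟨hu0, trivial⟩)
        exact continuousOn_univ.1 this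
      exact hcont.measurable.comp (hXm u)
    · exact hρm (measurableSet_singleton u)
  -- convergence of times
  have hlim : ∀ ω, Tendsto (fun k => ρ k (τ ω)) atTop (𝓝 (τ ω)) := by
    intro ω
    rw [Metric.tendsto_atTop]
    intro ε hε
    obtain ⟨K, hK⟩ := hmesh (ε / 2) (by positivity)
    refine ⟨K, fun k hk => ?_⟩
    have h1 := hge k ω
    have h3 := (hρ k (τ ω) (hτT ω)).2.2
    rw [Real.dist_eq, abs_of_nonneg (by linarith)]
    rcases (hτ ω).1.eq_or_lt with h0 | h0
    · have := h3 0 (hπ0 k) h0.ge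
      linarith
    · obtain ⟨x, hx, hmax⟩ := ((π k).filter (fun y => y < τ ω)).exists_max_image id
        ⟨0, by simp [hπ0 k, h0]⟩
      simp only [Finset.mem_filter, id] at hx hmax
      obtain ⟨y, hy, hxy, hyx⟩ := hK k hk x hx.1 (hx.2.trans_le (hτT ω)).ne
      have hty : τ ω ≤ y := by
        by_contra hcon
        exact absurd (hmax y ⟨hy, not_le.1 hcon⟩) (not_le.2 hxy)
      have := h3 y hy hty
      linarith [hx.2]
  have hXlim : ∀ ω, Tendsto (fun k => X (ρ k (τ ω)) ω) atTop (𝓝 (X (τ ω) ω)) := by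
    intro ω
    rcases (hτT ω).eq_or_lt with h | h
    · have : ∀ k, ρ k (τ ω) = τ ω := fun k =>
        le_antisymm ((hρ k (τ ω) (hτT ω)).2.2 _ (h ▸ hπT k) le_rfl) (hge k ω)
      simp only [this]
      exact tendsto_const_nhds
    · have hr := (hXcad ω).1 (τ ω) ⟨(hτ ω).1, h⟩
      have hr' : ContinuousWithinAt (fun t => X t ω) (Set.Ici (τ ω)) (τ ω) :=
        continuousWithinAt_Ioi_iff_Ici.1 hr
      exact hr'.tendsto.comp
        (tendsto_nhdsWithin_iff.2 ⟨hlim ω, Eventually.of_forall fun k => hge k ω⟩)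
  have hint : Tendsto (fun k => ∫ ω, γ (ρ k (τ ω)) (X (ρ k (τ ω)) ω) ∂P) atTop
      (𝓝 (∫ ω, γ (τ ω) (X (τ ω) ω) ∂P)) := by
    refine tendsto_integral_of_dominated_convergence (fun _ => C)
      (fun k => (hmeas k).aestronglyMeasurable) (integrable_const C)
      (fun k => Eventually.of_forall fun ω => hC _ (hIcc k ω).1 _)
      (Eventually.of_forall fun ω => ?_)
    have hc := hγc (τ ω, X (τ ω) ω) ⟨(hτ ω).1, trivial⟩
    exact hc.tendsto.comp (tendsto_nhdsWithin_iff.2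
      ⟨(hlim ω).prodMk_nhds (hXlim ω), Eventually.of_forall fun k => ⟨(hIcc k ω).1, trivial⟩⟩)
  filter_upwards [hint.eventually_const_lt hax] with k hk
  refine hk.trans_le ?_
  unfold optValueIn
  exact le_csSup (hbddk k) ⟨_, hst k, hIcc k, hmem k, rfl⟩
end

section
/- Take T = 1 and the deterministic càdlàg processes x_t = 1_{[1/2,1]}(t) and, for each n ≥ 1, xⁿ_t = 1_{[1/2 + 1/n, 1]}(t), and take γ(t,y) = min(y,2). Then the values in optimal stopping with horizon L = 1/2 satisfy Γ(1/2) = 1 while Γₙ(1/2) = 0 for every n; in particular liminf_n Γₙ(1/2) = 0 < 1 = Γ(1/2), even though xⁿ converges to x in the Skorokhod topology (note P[Δx_{1/2} ≠ 0] = 1 here). -/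
open MeasureTheory Filter Set Topology

lemma aux_value_zero (n : ℕ) (hn : 1 ≤ n) :
    sSup {z : ℝ | ∃ t ∈ Set.Icc (0 : ℝ) (1/2),
        z = min (Set.indicator (Set.Icc (1/2 + 1/(n : ℝ)) 1) (fun _ => (1 : ℝ)) t) 2} = 0 := by
  have hpos : (0 : ℝ) < 1 / (n : ℝ) := by
    have : (0 : ℝ) < n := by exact_mod_cast hn
    positivity
  have hind : ∀ t ∈ Set.Icc (0 : ℝ) (1/2),
      Set.indicator (Set.Icc (1/2 + 1/(n : ℝ)) 1) (fun _ => (1 : ℝ)) t = 0 := by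
    intro t ht
    apply Set.indicator_of_notMem
    intro h
    linarith [h.1, ht.2]
  apply IsGreatest.csSup_eq
  constructor
  · refine ⟨0, ⟨le_refl _, by norm_num⟩, ?_⟩
    rw [hind 0 ⟨le_refl _, by norm_num⟩]
    norm_num
  · rintro z ⟨t, ht, rfl⟩
    rw [hind t ht]
    norm_num

/-- (Counterexample at a fixed discontinuity of the horizon.)
With `x = 1_{[1/2,1]}`, `xⁿ = 1_{[1/2+1/n,1]}` and `γ(t,y) = min(y,2)`, one has
`Γ(1/2) = 1`, `Γₙ(1/2) = 0` for `n ≥ 1`, `liminf Γₙ(1/2) = 0 < 1 = Γ(1/2)`, even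
though `xⁿ → x` for the Skorokhod topology. -/
theorem counterexample_jump_at_horizon :
    (sSup {z : ℝ | ∃ t ∈ Set.Icc (0 : ℝ) (1/2),
        z = min (Set.indicator (Set.Icc (1/2 : ℝ) 1) (fun _ => (1 : ℝ)) t) 2} = 1) ∧
    (∀ n : ℕ, 1 ≤ n →
      sSup {z : ℝ | ∃ t ∈ Set.Icc (0 : ℝ) (1/2),
        z = min (Set.indicator (Set.Icc (1/2 + 1/(n : ℝ)) 1) (fun _ => (1 : ℝ)) t) 2} = 0) ∧
    (Filter.liminf (fun n : ℕ =>
        sSup {z : ℝ | ∃ t ∈ Set.Icc (0 : ℝ) (1/2),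
          z = min (Set.indicator (Set.Icc (1/2 + 1/(n : ℝ)) 1) (fun _ => (1 : ℝ)) t) 2})
        Filter.atTop = 0) ∧
    (∀ ε : ℝ, 0 < ε → ∃ N : ℕ, ∀ n ≥ N, ∃ Λ : ℝ → ℝ,
      ContinuousOn Λ (Set.Icc 0 1) ∧ StrictMonoOn Λ (Set.Icc 0 1) ∧
      Λ 0 = 0 ∧ Λ 1 = 1 ∧ Set.MapsTo Λ (Set.Icc 0 1) (Set.Icc 0 1) ∧
      ∀ t ∈ Set.Icc (0 : ℝ) 1,
        |Set.indicator (Set.Icc (1/2 + 1/(n : ℝ)) 1) (fun _ => (1 : ℝ)) (Λ t) -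
            Set.indicator (Set.Icc (1/2 : ℝ) 1) (fun _ => (1 : ℝ)) t| < ε ∧
        |Λ t - t| < ε) := by
  refine ⟨?_, aux_value_zero, ?_, ?_⟩
  · apply IsGreatest.csSup_eq
    constructor
    · refine ⟨1/2, ⟨by norm_num, le_refl _⟩, ?_⟩
      have hmem : (1/2 : ℝ) ∈ Set.Icc (1/2 : ℝ) 1 := ⟨le_refl _, by norm_num⟩
      rw [Set.indicator_of_mem hmem]
      norm_num
    · rintro z ⟨t, ht, rfl⟩
      refine (min_le_left _ _).trans ?_
      exact Set.indicator_apply_le' (fun _ => le_refl _) (fun _ => zero_le_one)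
  · rw [Filter.liminf_congr (v := fun _ : ℕ => (0 : ℝ))]
    · exact Filter.liminf_const 0
    · filter_upwards [Filter.eventually_ge_atTop 1] with n hn
      exact aux_value_zero n hn
  · intro ε hε
    have h1 : ∀ᶠ n : ℕ in Filter.atTop, 1 / (n : ℝ) < min ε (1/2) :=
      tendsto_one_div_atTop_nhds_zero_nat.eventually_lt_const (by positivity)
    obtain ⟨N, hN⟩ := Filter.eventually_atTop.1 h1
    refine ⟨max N 1, fun n hn => ?_⟩
    have hd := hN n (le_trans (le_max_left _ _) hn)
    have hn1 : 1 ≤ n := le_trans (le_max_right _ _) hn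
    have hpos : (0 : ℝ) < 1 / (n : ℝ) := by
      have : (0 : ℝ) < n := by exact_mod_cast hn1
      positivity
    generalize 1 / (n : ℝ) = d at hd hpos
    have hdε : d < ε := lt_of_lt_of_le hd (min_le_left _ _)
    have hd2 : d < 1/2 := lt_of_lt_of_le hd (min_le_right _ _)
    have hmono : StrictMono (fun t : ℝ => t + 2 * d * min t (1 - t)) := by
      intro a b hab
      show a + 2 * d * min a (1 - a) < b + 2 * d * min b (1 - b)
      rcases min_cases a (1 - a) with ⟨h, h'⟩ | ⟨h, h'⟩ <;>
      rcases min_cases b (1 - b) with ⟨k, k'⟩ | ⟨k, k'⟩ <;> rw [h, k] <;> nlinarith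
    have e0 : (0 : ℝ) + 2 * d * min 0 (1 - 0) = 0 := by norm_num
    have e1 : (1 : ℝ) + 2 * d * min 1 (1 - 1) = 1 := by norm_num
    have eh : (1/2 : ℝ) + 2 * d * min (1/2) (1 - 1/2) = 1/2 + d := by
      rw [show (1 : ℝ) - 1/2 = 1/2 by norm_num, min_self]; ring
    have hmaps : Set.MapsTo (fun t : ℝ => t + 2 * d * min t (1 - t))
        (Set.Icc 0 1) (Set.Icc 0 1) := by
      intro t ht
      have a := hmono.monotone ht.1
      have b := hmono.monotone ht.2
      simp only [e0, e1] at a b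
      exact ⟨a, b⟩
    refine ⟨fun t => t + 2 * d * min t (1 - t), by fun_prop, hmono.strictMonoOn _, e0, e1,
      hmaps, ?_⟩
    intro t ht
    have hm := hmaps ht
    constructor
    · have key : t + 2 * d * min t (1 - t) ∈ Set.Icc (1/2 + d) 1 ↔ t ∈ Set.Icc (1/2 : ℝ) 1 := by
        have h := hmono.le_iff_le (a := 1/2) (b := t)
        simp only [eh] at h
        exact ⟨fun q => ⟨h.1 q.1, ht.2⟩, fun q => ⟨h.2 q.1, hm.2⟩⟩
      by_cases h : t ∈ Set.Icc (1/2 : ℝ) 1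
      · rw [Set.indicator_of_mem h, Set.indicator_of_mem (key.2 h)]
        simpa using hε
      · rw [Set.indicator_of_notMem h, Set.indicator_of_notMem (fun q => h (key.1 q))]
        simpa using hε
    · have hmin0 : 0 ≤ min t (1 - t) := le_min ht.1 (by linarith [ht.2])
      have hmin1 : min t (1 - t) ≤ 1/2 := by
        rcases min_cases t (1 - t) with ⟨h, h'⟩ | ⟨h, h'⟩ <;> linarith
      show |t + 2 * d * min t (1 - t) - t| < ε
      rw [add_sub_cancel_left, abs_of_nonneg (by positivity)]
      nlinarith
end
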